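/- Let G be a connected graph of order n with minimum degree δ(G) ≥ 3. If γ_P(G) ≥ 3n/16, then th_pd×(G) = γ(G). -/

import Mathlib

open SimpleGraph Set

variable {V : Type*} {W : Type*}

/-- The closed neighborhood of a set `S`. -/
def closedNbhdSet (G : SimpleGraph V) (S : Set V) : Set V :=
  S ∪ {w | ∃ u ∈ S, G.Adj u w}

/-- One round of the zero forcing propagation step. -/
def pdStep (G : SimpleGraph V) (A : Set V) : Set V :=
  A ∪ {w | ∃ u ∈ A, G.neighborSet u \ A = {w}}

/-- `obs G S k` is the set `P^[k](S)` of vertices observed after round `k`. -/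
def obs (G : SimpleGraph V) (S : Set V) : ℕ → Set V
  | 0 => S
  | 1 => closedNbhdSet G S
  | (n + 2) => pdStep G (obs G S (n + 1))

/-- `S` is a power dominating set. -/
def IsPDS (G : SimpleGraph V) (S : Set V) : Prop :=
  ∃ t, obs G S t = Set.univ

/-- The power propagation time `pt_pd(G;S)`: least positive `t` with `P^[t](S) = V(G)`. -/
noncomputable def ptpd (G : SimpleGraph V) (S : Set V) : ℕ :=
  sInf {t | 1 ≤ t ∧ obs G S t = Set.univ}

/-- `S` is a dominating set. -/
def IsDomSet (G : SimpleGraph V) (S : Set V) : Prop :=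
  closedNbhdSet G S = Set.univ

/-- The domination number `γ(G)`. -/
noncomputable def gamma (G : SimpleGraph V) : ℕ :=
  sInf {k | ∃ S : Set V, IsDomSet G S ∧ S.ncard = k}

/-- The power domination number `γ_P(G)`. -/
noncomputable def gammaP (G : SimpleGraph V) : ℕ :=
  sInf {k | ∃ S : Set V, IsPDS G S ∧ S.ncard = k}

/-- The product power throttling number `th_pd^×(G)`. -/
noncomputable def thpd (G : SimpleGraph V) : ℕ :=
  sInf {m | ∃ S : Set V, IsPDS G S ∧ m = S.ncard * ptpd G S}

/-- The power propagation time of `G`: minimum over minimum power dominating sets. -/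
noncomputable def ptG (G : SimpleGraph V) : ℕ :=
  sInf {t | ∃ S : Set V, IsPDS G S ∧ S.ncard = gammaP G ∧ t = ptpd G S}

/-- `newObs G S k` is `P^(k)(S)`, the set of vertices first observed in round `k`. -/
def newObs (G : SimpleGraph V) (S : Set V) : ℕ → Set V
  | 0 => S
  | (k + 1) => obs G S (k + 1) \ obs G S k

/-- `rd G S v` is the round in which `v` is first observed. -/
noncomputable def rd (G : SimpleGraph V) (S : Set V) (v : V) : ℕ :=
  sInf {k | v ∈ obs G S k}

open SimpleGraph Set

namespace Reed

/-- Certificates for the small in-in 1-paths. -/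
inductive HCert
  | nil
  | node (path : ℕ) (b1 b2 : ℕ) (kids sibs : HCert)

def eb (E i j : ℕ) : Bool := E.testBit (i * 16 + j)

def addE (E i j : ℕ) : ℕ := E ||| 2 ^ (i * 16 + j) ||| 2 ^ (j * 16 + i)

def decPath : ℕ → ℕ → List ℕ
  | 0, _ => []
  | k + 1, p => p % 16 :: decPath k (p / 16)

def chainB (E : ℕ) : List ℕ → Bool
  | [] => true
  | a :: t => match t with
    | [] => true
    | b :: _ => eb E a b && chainB E t

def orRows (E : ℕ) : List ℕ → ℕ
  | [] => 0
  | d :: t => (((E >>> (d * 16)) % 65536) ||| 2 ^ d) ||| orRows E t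

def domB (m E : ℕ) (D : List ℕ) : Bool := Nat.beq (orRows E D) (2 ^ m - 1)

def opens (m : ℕ) (Ds : List (List ℕ)) (E F x b1 b2 : ℕ) : List ℕ :=
  (List.range m).filter fun z =>
    !(Nat.beq z x || Nat.beq z b1 || Nat.beq z b2 || eb F x z || Ds.any (domB m (addE E x z)))

def chk (m : ℕ) (Ds : List (List ℕ)) : HCert → ℕ → ℕ → ℕ → List ℕ → Bool
  | .nil, _, _, _, pend => pend.isEmpty
  | .node p b1 b2 kids sibs, E, F, x, pend =>
    match pend with
    | [] => true
    | z :: zs =>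
      let E' := addE E x z
      let l := decPath m p
      ((List.range m).all fun i => l.elem i) && chainB E' l &&
        (chk m Ds kids E' F (p % 16) (opens m Ds E' F (p % 16) b1 b2)) &&
        (chk m Ds sibs E (addE F x z) x zs)

def startE : ℕ → ℕ
  | 0 => 0
  | k + 1 => addE (startE k) k (k + 1)

def cert7 : HCert :=
    .node 106181136 1 6 (.node 106181136 1 3 (.node 106169121 0 2 (.node 106180626 1 3 .nil .nil)
    (.node 100737861 4 6 .nil .nil)) (.node 106181136 1 4 (.node 54878226 1 3 .nil .nil) .nil))
    .nil
def dsets7 : List (List ℕ) :=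
  [[2, 5], [3, 5], [4, 5], [2, 4], [1, 4], [0, 5], [0, 3], [0, 4], [0, 2]]

def cert10 : HCert :=
    .node 654820258320 1 9 (.node 654820258320 1 3 (.node 654820246305 0 2 (.node 654820257810 1 3
    .nil (.node 654820257810 1 3 .nil .nil)) (.node 654814815045 4 6 (.node 412622280585 8 6
    (.node 641076364920 7 9 .nil .nil) (.node 641076364920 7 9 .nil .nil)) (.node 434917934985 8 6
    (.node 444680184645 4 6 .nil (.node 298080871320 7 9 (.node 152878540545 0 2 .nil .nil) .nil))
    (.node 151488268545 0 2 (.node 654820257810 1 3 .nil (.node 444680184645 4 6 .nil .nil))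
    .nil)))) (.node 654820258320 1 4 (.node 654820245795 2 4 (.node 654818021445 4 6 (.node
    654804271905 0 2 (.node 654804467730 1 3 .nil .nil) (.node 152060908545 0 2 .nil .nil)) (.node
    654768955410 1 3 (.node 224781215625 8 3 .nil .nil) (.node 152881746945 0 2 .nil .nil)))
    (.node 654715270230 5 7 (.node 654718624545 0 2 (.node 434917934985 8 0 .nil .nil) (.node
    224791130130 1 3 .nil .nil)) (.node 224789041170 1 3 .nil .nil))) (.node 654820258320 1 6
    (.node 434917934985 8 6 (.node 618780710520 7 9 .nil (.node 654720713505 0 2 .nil .nil))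
    (.node 618780710520 7 9 .nil .nil)) (.node 654820258320 1 7 (.node 224789041170 1 3 (.node
    298089775395 2 4 (.node 371389895220 3 5 .nil .nil) (.node 371389895220 3 5 .nil .nil)) .nil)
    .nil)))) .nil
def dsets10 : List (List ℕ) :=
    [[2, 5, 8], [3, 6, 8], [1, 4, 7], [1, 5, 8], [4, 7, 9], [0, 5, 8], [1, 4, 8], [2, 5, 7], [2,
    4, 8], [1, 6, 9], [0, 4, 7], [3, 5, 8], [0, 3, 8], [1, 5, 9], [2, 6, 8], [1, 3, 8], [0, 4, 8],
    [2, 5, 9], [0, 2, 8], [2, 4, 7], [2, 4, 9], [2, 3, 7], [0, 3, 5], [4, 6, 9], [3, 5, 7], [0, 5,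
    7], [0, 2, 6], [0, 2, 7], [3, 7, 8], [1, 3, 9], [1, 3, 7], [3, 4, 8], [1, 4, 9], [2, 6, 7],
    [0, 2, 9], [0, 2, 5], [0, 3, 4], [0, 2, 4]]

def cert13 : HCert :=
    .node 3582863703552528 1 12 (.node 3582863703552528 1 3 (.node 3582863703540513 0 2 (.node
    3582863703552018 1 3 .nil (.node 3582863703552018 1 3 .nil (.node 3582863703552018 1 3 .nil
    .nil))) (.node 3582863698109253 4 6 (.node 3582863703552018 1 3 (.node 3582863685658113 0 2 .nil
    (.node 3582863634355713 0 2 (.node 1781415305321148 11 9 (.node 1781415305333673 8 10 (.node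
    1781415305321658 9 11 (.node 1781415305333163 10 12 .nil .nil) .nil) .nil) .nil) (.node
    2682143775992508 11 6 .nil .nil))) (.node 3582849959659128 7 9 (.node 2625848790715068 11 9
    (.node 3526546412558763 10 12 .nil .nil) (.node 3526546412558763 10 12 .nil .nil)) (.node
    2682121482427068 11 9 (.node 2722138513540728 7 9 .nil (.node 2121667725821643 10 12 (.node
    2714982525881208 7 9 .nil .nil) .nil)) (.node 620522825610753 0 2 (.node 3582863703552018 1 3
    .nil .nil) .nil)))) (.node 3582863703552018 1 3 (.node 3582863703548673 0 2 .nil (.node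
    3582863700198213 4 6 (.node 3582863600801313 0 2 (.node 1781423861701308 11 9 (.node
    1781423861713833 8 10 (.node 1781423861701818 9 11 (.node 1781423861713323 10 12 .nil .nil) .nil)
    .nil) .nil) (.node 2682130038807228 11 6 .nil .nil)) (.node 1781423861701308 11 9 (.node
    1220947805518488 7 9 (.node 3582862882710273 0 2 .nil (.node 3582863631987798 5 7 (.node
    3582863631988308 3 5 (.node 1781698735683738 9 11 (.node 1781423861831868 3 11 .nil .nil) .nil)
    (.node 1221332629398273 0 2 .nil .nil)) (.node 3282644344272468 3 5 (.node 3582863631987798 5 7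
    (.node 1781698735671723 10 12 (.node 1781423861713833 8 10 .nil .nil) .nil) (.node
    3529068417327873 0 2 .nil .nil)) .nil))) (.node 1221332629398273 0 2 .nil (.node 1781423861701308
    8 11 (.node 1781423861701818 9 11 (.node 1781423861713323 10 12 .nil .nil) .nil) .nil))) (.node
    2682143775992508 11 6 (.node 3310927592106648 7 9 (.node 3310812454545153 0 2 .nil .nil) .nil)
    .nil)))) (.node 3582863703552018 1 3 (.node 3582827664004728 7 9 (.node 2534525790292668 11 9
    (.node 1521229006639668 3 5 .nil .nil) (.node 1521229006639668 3 5 .nil .nil)) (.node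
    3582836220384888 7 9 (.node 3582836220397413 4 6 (.node 3582836220385398 5 7 (.node
    3582653500696833 0 2 .nil .nil) (.node 2381903802964668 11 9 (.node 2121695591806038 5 7 .nil
    (.node 2121695625229398 5 7 .nil (.node 3021672979712118 5 7 .nil (.node 1821091025199873 0 2
    .nil (.node 2081688165884673 0 2 .nil .nil))))) (.node 3582580268148993 0 2 .nil (.node
    1821091025199873 0 2 .nil .nil)))) (.node 3582836220385398 5 7 (.node 2381903802964668 11 9
    (.node 2117013736526388 3 5 .nil (.node 2117013736656948 3 5 .nil (.node 3021672979920468 3 5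
    (.node 3582507507852033 0 2 .nil .nil) (.node 3021837899534388 3 5 (.node 3582507507852033 0 2
    .nil .nil) (.node 1223167153087233 0 2 .nil (.node 1220976719766273 0 2 .nil .nil)))))) (.node
    3582653500696833 0 2 .nil (.node 1223167153087233 0 2 .nil .nil))) (.node 3582790402779393 0 2
    .nil (.node 1220976719766273 0 2 .nil .nil)))) (.node 3582360371562753 0 2 (.node
    2682143775992508 11 11 .nil (.node 2682143775992508 11 11 .nil (.node 620495947963068 11 2 .nil
    .nil))) (.node 3413997653559723 10 12 .nil .nil)))) (.node 2682143778081468 11 9 (.node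
    3582863703552018 1 3 (.node 1521215873225268 3 5 .nil (.node 3378950720424363 10 12 .nil .nil))
    (.node 1220975886672843 10 12 (.node 629695195945473 0 2 .nil (.node 3582213770012553 8 10 .nil
    .nil)) (.node 2682143778081468 6 11 (.node 3317914081187448 7 9 .nil .nil) .nil))) (.node
    620495948659713 0 2 (.node 3582863703552018 1 3 .nil (.node 1821455834751813 4 6 .nil (.node
    3282623728394508 0 11 .nil .nil))) .nil)))))) (.node 3582863703552528 1 4 (.node 3582863703540003
    2 4 (.node 3582863701315653 4 6 (.node 3582863687566113 0 2 (.node 3582863687761938 1 3 .nil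
    (.node 3582863687761938 1 3 .nil .nil)) (.node 3582849959659128 7 9 (.node 2625848790715068 11 9
    (.node 622842394268673 0 2 .nil .nil) (.node 622842394268673 0 2 .nil .nil)) (.node
    2682134615841468 11 9 (.node 622841573430273 0 2 .nil (.node 2121667725821643 10 12 (.node
    623197483062273 0 2 .nil .nil) .nil)) (.node 622841573430273 0 2 .nil .nil)))) (.node
    3582863652249618 1 3 (.node 3582863634355713 0 2 (.node 920703859202748 11 9 (.node
    920703859215273 8 10 (.node 920703859203258 9 11 (.node 920703859214763 10 12 .nil .nil) .nil)
    .nil) .nil) (.node 2681933641362108 11 3 .nil .nil)) (.node 3582840797419128 7 9 (.node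
    2588320255675068 11 9 (.node 626359918810113 0 2 .nil .nil) (.node 626359918810113 0 2 .nil
    .nil)) (.node 2682143726779068 11 9 (.node 2682143787171858 1 3 .nil (.node 629722072896513 0 2
    .nil (.node 2121658563581643 10 12 (.node 627376539456513 0 2 .nil .nil) .nil))) (.node
    629722072896513 0 2 .nil .nil))))) (.node 3582863598564438 5 7 (.node 3582863601918753 0 2
    (.node 3582863614432818 1 3 (.node 1781423861701308 11 9 (.node 1781423861713833 8 10 (.node
    1781423861701818 9 11 (.node 1781423861713323 10 12 .nil .nil) .nil) .nil) .nil) (.node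
    2681727486139068 11 0 .nil .nil)) (.node 3582854540955768 7 9 (.node 3582863703540003 2 4 (.node
    3582863168520993 0 2 (.node 3582863168716818 1 3 .nil .nil) (.node 3582433707847698 1 3 .nil
    .nil)) (.node 2644613781752508 11 9 (.node 920745086054418 1 3 .nil .nil) (.node
    920745086054418 1 3 .nil .nil))) (.node 3582643801229193 8 10 (.node 3582653563478853 4 6 (.node
    3582863703344178 1 3 (.node 3582863703540003 2 4 .nil .nil) (.node 1821410036308668 11 6 .nil
    .nil)) (.node 3582643756634913 0 2 (.node 3582643809054738 1 3 .nil .nil) (.node 920749663088658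
    1 3 .nil .nil))) (.node 920758219468818 1 3 .nil .nil)))) (.node 3582863703540003 2 4 (.node
    3582827664004728 7 9 (.node 2534525790292668 11 9 (.node 1481486905282578 1 3 .nil .nil) (.node
    1481486905282578 1 3 .nil .nil)) (.node 3582863649866838 5 7 (.node 3582854537749368 7 9 (.node
    3582797366588193 0 2 (.node 3582789581967378 1 3 .nil .nil) (.node 624027518784513 0 2 .nil
    .nil)) (.node 3582643806965778 1 3 (.node 3582360371562753 0 2 .nil .nil) (.node 624014385370113
    0 2 .nil .nil))) (.node 3582840797419128 7 9 (.node 3582840797431653 4 6 (.node 3582840797419638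
    5 7 (.node 3582840797431143 6 8 .nil .nil) (.node 2381903802964668 11 9 (.node 2381903930572818 1
    3 .nil (.node 629722072896513 0 2 .nil (.node 626359867507713 0 2 .nil (.node 626359918810113
    0 2 .nil .nil)))) (.node 3582580273201953 0 2 (.node 3582580273397778 1 3 .nil .nil) (.node
    626359867507713 0 2 .nil .nil)))) (.node 3582840797419638 5 7 (.node 2381903802964668 11 9
    (.node 2381903930572818 1 3 .nil (.node 629722072896513 0 2 .nil (.node 3021837899416353 0 2
    .nil (.node 626359885386753 0 2 .nil (.node 626359918810113 0 2 .nil .nil))))) (.node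
    3582653500527393 0 2 (.node 3582653500723218 1 3 .nil .nil) (.node 626359885386753 0 2 .nil
    .nil))) (.node 3582790402609953 0 2 (.node 3582790402805778 1 3 .nil .nil) (.node
    626359918810113 0 2 .nil .nil)))) (.node 3582433672335378 1 3 (.node 920735912635068 11 3 .nil
    .nil) (.node 629722072896513 0 2 .nil .nil))))) (.node 2682143778081468 11 9 (.node
    920735923814418 1 3 .nil (.node 629722072896513 0 2 .nil (.node 2682143778081468 6 11 (.node
    920735925903378 1 3 .nil .nil) .nil))) (.node 920735923814418 1 3 .nil .nil))))) (.node
    3582863703552528 1 6 (.node 3582863604007713 0 2 (.node 3582863604007203 2 4 (.node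
    3582863652249618 1 3 (.node 1781423861701308 11 9 (.node 1781423861713833 8 10 (.node
    1781423861701818 9 11 (.node 1781423861713323 10 12 .nil .nil) .nil) .nil) .nil) (.node
    2681736040430268 11 0 .nil .nil)) (.node 3582863603995188 3 5 (.node 3582863670116643 2 4 .nil
    (.node 2681735991216828 11 0 .nil .nil)) (.node 3582863698109253 4 6 (.node 3582863614562868 3 5
    .nil .nil) (.node 2681736042519228 11 0 .nil .nil)))) (.node 3582827664004728 7 9 (.node
    2534525790292668 11 9 (.node 3526568708213163 10 12 .nil .nil) (.node 3526568708213163 10 12 .nil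
    .nil)) (.node 2682143778081468 11 9 (.node 2722116217886328 7 9 .nil (.node 3582863698109253 4 6
    (.node 3582236676145953 0 2 .nil .nil) (.node 2121645430167243 10 12 (.node 2709274838354808 7 9
    .nil .nil) .nil))) (.node 2722116217886328 7 9 (.node 3021462839846793 8 10 (.node
    3307409163843738 9 11 .nil .nil) (.node 3307409163843738 9 11 .nil .nil)) .nil)))) (.node
    3582863703552528 1 7 (.node 3582827664004728 7 9 (.node 2381903802964668 11 9 (.node
    3385831219890603 10 12 .nil (.node 3526568708213163 10 12 .nil .nil)) (.node 3582863598564438 5 7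
    (.node 2681713746864828 11 11 .nil .nil) (.node 2534525790292668 11 9 (.node 3526568708213163 10
    12 .nil .nil) (.node 3526568708213163 10 12 .nil .nil)))) (.node 3582213770012553 8 10 (.node
    2682143778081468 11 9 (.node 1821455834751813 4 6 .nil (.node 1220975886672843 10 12 .nil (.node
    620497342138113 0 2 .nil .nil))) (.node 3582241253180193 0 2 (.node 3582241253179683 2 4 (.node
    2682143778081468 11 0 .nil .nil) (.node 3582241253167668 3 5 (.node 3582507006492963 2 4 .nil
    .nil) (.node 2682143778081468 11 0 .nil .nil))) (.node 3545333706657963 10 12 (.node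
    3272224791754908 9 11 .nil .nil) .nil))) (.node 920735923814418 1 3 (.node 1220975898919203 2 4
    (.node 1521215873225268 3 5 .nil .nil) (.node 1521215873225268 3 5 .nil .nil)) .nil))) (.node
    3582863703552528 1 9 (.node 2682143778081468 11 9 (.node 3378950720424363 10 12 .nil (.node
    3582249809560353 0 2 .nil (.node 3582827664004728 7 9 .nil .nil))) (.node 3378950720424363 10 12
    .nil .nil)) (.node 3582863703552528 1 10 (.node 3378950720424363 10 12 (.node 3282623728394508 0
    11 .nil (.node 920735923814418 1 3 .nil (.node 3582213770012553 8 10 .nil .nil))) .nil)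
    .nil)))))) .nil
def dsets13 : List (List ℕ) :=
    [[3, 6, 9, 12], [2, 4, 7, 10], [2, 5, 8, 11], [3, 6, 8, 11], [1, 4, 8, 11], [1, 5, 8, 11], [4,
    7, 10, 11], [1, 4, 7, 11], [3, 4, 7, 10], [3, 4, 7, 11], [0, 4, 7, 10], [0, 2, 5, 8], [0, 6,
    9, 11], [1, 4, 7, 10], [0, 5, 8, 11], [3, 5, 8, 10], [2, 6, 9, 11], [4, 7, 9, 12], [0, 3, 6,
    10], [2, 5, 7, 10], [1, 3, 6, 11], [0, 3, 8, 11], [1, 3, 7, 11], [0, 3, 6, 12], [1, 4, 7, 12],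
    [2, 5, 7, 11], [2, 5, 9, 11], [1, 6, 8, 11], [0, 2, 6, 11], [1, 4, 9, 12], [3, 5, 8, 11], [0,
    3, 8, 10], [2, 4, 8, 11], [1, 4, 6, 10], [0, 4, 8, 11], [1, 4, 7, 9], [3, 6, 8, 10], [0, 2, 7,
    11], [3, 7, 10, 12], [0, 3, 6, 8], [4, 6, 9, 12], [0, 5, 8, 10], [2, 5, 6, 10], [2, 4, 9, 12],
    [3, 6, 9, 11], [1, 3, 7, 10], [0, 3, 6, 11], [1, 3, 8, 11], [0, 6, 8, 10], [1, 4, 6, 11], [1,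
    3, 9, 12], [2, 4, 7, 11], [2, 6, 8, 11], [2, 5, 8, 10], [0, 5, 9, 12], [2, 4, 7, 12], [0, 2,
    9, 12], [0, 4, 7, 11], [0, 3, 7, 11], [1, 3, 8, 12], [0, 4, 9, 11], [0, 5, 7, 10], [2, 5, 6,
    11], [0, 3, 6, 7], [1, 6, 9, 10], [0, 2, 7, 10], [0, 3, 5, 11], [1, 6, 7, 11], [2, 5, 7, 12],
    [0, 5, 10, 11], [2, 4, 6, 12], [0, 2, 8, 11], [1, 5, 8, 10], [0, 2, 6, 9], [1, 3, 6, 12], [2,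
    6, 8, 10], [0, 5, 8, 12], [2, 5, 6, 8], [2, 3, 8, 11], [1, 4, 10, 12], [0, 4, 7, 9], [3, 7, 8,
    11], [2, 4, 8, 12], [3, 4, 8, 11], [0, 2, 6, 10], [1, 3, 7, 12], [1, 3, 6, 9], [1, 7, 10, 12],
    [2, 7, 10, 11], [0, 2, 5, 9], [4, 6, 7, 10], [0, 5, 7, 11], [4, 6, 7, 11], [1, 4, 7, 8], [2,
    5, 8, 12], [0, 3, 5, 10], [0, 3, 4, 8], [0, 4, 6, 11], [3, 8, 10, 12], [2, 8, 9, 10], [1, 6,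
    8, 12], [4, 6, 9, 10], [0, 5, 9, 11], [0, 3, 7, 9], [1, 4, 8, 12], [5, 7, 10, 12], [4, 8, 10,
    11], [1, 6, 7, 10], [1, 3, 6, 10], [0, 2, 4, 10], [0, 4, 6, 9], [2, 3, 7, 12], [0, 3, 9, 11],
    [2, 3, 8, 10], [1, 6, 10, 12], [1, 5, 9, 11], [2, 3, 8, 12], [3, 6, 10, 11], [4, 7, 9, 10],
    [0, 3, 5, 8], [3, 7, 9, 11], [4, 7, 10, 12], [0, 4, 8, 10], [0, 6, 8, 11], [3, 4, 8, 10], [2,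
    6, 7, 12], [0, 2, 9, 10], [2, 4, 9, 10], [0, 4, 9, 12], [0, 1, 7, 11], [0, 2, 7, 12], [1, 4,
    8, 10], [2, 5, 10, 12], [0, 2, 5, 11], [1, 4, 6, 12], [1, 6, 9, 11], [3, 6, 7, 11], [2, 6, 7,
    11], [0, 2, 5, 10], [0, 4, 7, 8]]


theorem cert7_ok : chk 7 dsets7 cert7 (startE 6) 0 0 [1] = true := by decide +kernel
theorem cert10_ok : chk 10 dsets10 cert10 (startE 9) 0 0 [1] = true := by decide +kernel
theorem cert13_ok : chk 13 dsets13 cert13 (startE 12) 0 0 [1] = true := by decide +kernel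
theorem ds7_ok : (dsets7.all fun D => D.length == 2 && D.all (· < 7)) = true := by decide +kernel
theorem ds10_ok : (dsets10.all fun D => D.length == 3 && D.all (· < 10)) = true := by decide +kernel
theorem ds13_ok : (dsets13.all fun D => D.length == 4 && D.all (· < 13)) = true := by decide +kernel

end Reed

open SimpleGraph Set

namespace Reed

theorem eb_addE {E i j a b : ℕ} (ha : a < 16) (hb : b < 16) (hj : j < 16)
    (h : eb (addE E a b) i j = true) : eb E i j = true ∨ (i = a ∧ j = b) ∨ (i = b ∧ j = a) := by
  unfold eb addE at *
  rw [Nat.testBit_or, Nat.testBit_or, Nat.testBit_two_pow, Nat.testBit_two_pow] at h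
  simp only [Bool.or_eq_true, decide_eq_true_eq] at h
  rcases h with (h | h) | h
  · exact Or.inl h
  · right; left; omega
  · right; right; omega

def InvE (H : ℕ → ℕ → Prop) (E : ℕ) : Prop := ∀ i j, j < 16 → eb E i j = true → H i j

theorem InvE.add {H : ℕ → ℕ → Prop} (hs : ∀ i j, H i j → H j i) {E a b : ℕ} (hE : InvE H E)
    (ha : a < 16) (hb : b < 16) (h : H a b) : InvE H (addE E a b) := by
  intro i j hj hij
  rcases eb_addE ha hb hj hij with h1 | ⟨rfl, rfl⟩ | ⟨rfl, rfl⟩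
  · exact hE i j hj h1
  · exact h
  · exact hs _ _ h

theorem chainB_sound {H : ℕ → ℕ → Prop} {E : ℕ} (hE : InvE H E) :
    ∀ l : List ℕ, (∀ a ∈ l, a < 16) → chainB E l = true → l.IsChain H
  | [], _, _ => List.isChain_nil
  | [a], _, _ => List.isChain_singleton a
  | a :: b :: t, hl, h => by
    rw [chainB, Bool.and_eq_true] at h
    rw [List.isChain_cons_cons]
    exact ⟨hE a b (hl b (by simp)) h.1,
      chainB_sound hE (b :: t) (fun c hc => hl c (List.mem_cons_of_mem _ hc)) h.2⟩

theorem decPath_length : ∀ m p, (decPath m p).length = m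
  | 0, _ => rfl
  | m + 1, p => by simp [decPath, decPath_length m]

theorem orRows_sound {H : ℕ → ℕ → Prop} {E : ℕ} (hE : InvE H E) {i : ℕ} (hi : i < 16) :
    ∀ D : List ℕ, (orRows E D).testBit i = true → ∃ d ∈ D, d = i ∨ H d i
  | [], h => by simp [orRows] at h
  | d :: t, h => by
    rw [orRows, Nat.testBit_or, Nat.testBit_or, Nat.testBit_two_pow] at h
    simp only [Bool.or_eq_true, decide_eq_true_eq] at h
    rcases h with (h | h) | h
    · rw [show (65536 : ℕ) = 2 ^ 16 by norm_num, Nat.testBit_mod_two_pow, Nat.testBit_shiftRight] at h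
      simp only [Bool.and_eq_true] at h
      exact ⟨d, by simp, Or.inr (hE d i hi h.2)⟩
    · exact ⟨d, by simp, Or.inl h⟩
    · obtain ⟨e, he, h⟩ := orRows_sound hE hi t h
      exact ⟨e, by simp [he], h⟩

theorem domB_sound {H : ℕ → ℕ → Prop} {E m : ℕ} (hm : m ≤ 16) (hE : InvE H E) {D : List ℕ}
    (h : domB m E D = true) : ∀ i < m, ∃ d ∈ D, d = i ∨ H d i := by
  intro i hi
  have h' := Nat.eq_of_beq_eq_true h
  apply orRows_sound hE (by omega)
  rw [h', Nat.testBit_two_pow_sub_one]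
  simpa using hi

theorem chk_sound {H : ℕ → ℕ → Prop} (hs : ∀ i j, H i j → H j i) {m : ℕ} (hm : m ≤ 16) (hm0 : 0 < m)
    (Ds : List (List ℕ))
    (hdeg : ∀ l : List ℕ, l.Perm (List.range m) → l.IsChain H → ∀ x t, l = x :: t → ∀ b1 b2,
      ∃ z < m, z ≠ x ∧ z ≠ b1 ∧ z ≠ b2 ∧ H x z) :
    ∀ (c : HCert) (E F x : ℕ) (pend : List ℕ), chk m Ds c E F x pend = true →
      InvE H E → InvE (fun i j => ¬ H i j) F → x < 16 → (∀ z ∈ pend, z < 16) →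
      (∃ z ∈ pend, H x z) → ∃ D ∈ Ds, ∀ i < m, ∃ d ∈ D, d = i ∨ H d i
  | .nil, E, F, x, pend, h, _, _, _, _, hz => by
    obtain ⟨z, hz, -⟩ := hz
    simp [chk] at h
    simp [h] at hz
  | .node p b1 b2 kids sibs, E, F, x, pend, h, hE, hF, hx, hp, hz => by
    match pend, h, hp, hz with
    | [], _, _, hz => simp at hz
    | z :: zs, h, hp, hz =>
      simp only [chk, Bool.and_eq_true] at h
      obtain ⟨⟨⟨h1, h2⟩, h3⟩, h4⟩ := h
      by_cases hxz : H x z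
      · have hE' := hE.add hs hx (hp z (by simp)) hxz
        have hperm : (decPath m p).Perm (List.range m) := by
          have hsub : List.range m ⊆ decPath m p := by
            intro i hi
            simpa using List.all_eq_true.1 h1 i hi
          have := (List.subperm_of_subset (List.nodup_range) hsub)
          exact (this.perm_of_length_le (by simp [decPath_length])).symm
        have hch : (decPath m p).IsChain H := by
          apply chainB_sound hE' _ _ h2
          intro a ha
          have := hperm.mem_iff.1 ha
          rw [List.mem_range] at this; omega
        obtain ⟨m', rfl⟩ : ∃ m', m = m' + 1 := ⟨m - 1, by omega⟩
        obtain ⟨w, hw, hwx, hw1, hw2, hH⟩ := hdeg _ hperm hch (p % 16) _ rfl b1 b2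
        have hx' : p % 16 < 16 := Nat.mod_lt _ (by norm_num)
        by_cases hd : ∃ D ∈ Ds, domB (m' + 1) (addE (addE E x z) (p % 16) w) D = true
        · obtain ⟨D, hD, hd⟩ := hd
          exact ⟨D, hD, domB_sound hm (hE'.add hs hx' (by omega) hH) hd⟩
        · refine chk_sound hs hm hm0 Ds hdeg kids _ F _ _ h3 hE' hF hx' ?_ ⟨w, ?_, hH⟩
          · intro z hz
            have := List.mem_of_mem_filter hz
            rw [List.mem_range] at this; omega
          · rw [opens, List.mem_filter, List.mem_range]
            refine ⟨hw, ?_⟩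
            have e1 : eb F (p % 16) w = false := by
              by_contra hc
              exact hF _ _ (by omega) (by simpa using hc) hH
            have e2 : Ds.any (domB (m' + 1) (addE (addE E x z) (p % 16) w)) = false := by
              by_contra hc
              apply hd
              simpa using hc
            simp only [e1, e2, Bool.or_false, Bool.not_eq_true', Bool.or_eq_false_iff]
            refine ⟨⟨?_, ?_⟩, ?_⟩ <;>
            · rw [Bool.eq_false_iff]; intro h; exact absurd (Nat.eq_of_beq_eq_true h) (by assumption)
      · refine chk_sound hs hm hm0 Ds hdeg sibs E _ x zs h4 hE ?_ hx
          (fun a ha => hp a (List.mem_cons_of_mem _ ha)) ?_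
        · exact hF.add (fun i j h h' => h (hs _ _ h')) hx (hp z (by simp)) hxz
        · obtain ⟨a, ha, hxa⟩ := hz
          rcases List.mem_cons.1 ha with rfl | ha
          · exact absurd hxa hxz
          · exact ⟨a, ha, hxa⟩

theorem startE_inv {H : ℕ → ℕ → Prop} (hs : ∀ i j, H i j → H j i) :
    ∀ k, k < 16 → (∀ i < k, H i (i + 1)) → InvE H (startE k)
  | 0, _, _ => by intro i j _ h; simp [startE, eb] at h
  | k + 1, hk, h => by
    rw [startE]
    exact (startE_inv hs k (by omega) (fun i hi => h i (by omega))).add hs (by omega) (by omega)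
      (h k (by omega))

theorem small_sound {H : ℕ → ℕ → Prop} (hs : ∀ i j, H i j → H j i) {m k : ℕ}
    (hmk : (m = 7 ∧ k = 2) ∨ (m = 10 ∧ k = 3) ∨ (m = 13 ∧ k = 4))
    (hpath : ∀ i, i + 1 < m → H i (i + 1))
    (hdeg : ∀ l : List ℕ, l.Perm (List.range m) → l.IsChain H → ∀ x t, l = x :: t → ∀ b1 b2,
      ∃ z < m, z ≠ x ∧ z ≠ b1 ∧ z ≠ b2 ∧ H x z) :
    ∃ D : List ℕ, D.length = k ∧ (∀ d ∈ D, d < m) ∧ ∀ i < m, ∃ d ∈ D, d = i ∨ H d i := by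
  have key : ∀ Ds : List (List ℕ), ∀ c, chk m Ds c (startE (m - 1)) 0 0 [1] = true →
      (Ds.all fun D => D.length == k && D.all (· < m)) = true →
      ∃ D : List ℕ, D.length = k ∧ (∀ d ∈ D, d < m) ∧ ∀ i < m, ∃ d ∈ D, d = i ∨ H d i := by
    intro Ds c h1 h2
    obtain ⟨D, hD, hd⟩ := chk_sound hs (by omega) (by omega) Ds hdeg c _ _ _ _ h1
      (startE_inv hs _ (by omega) (fun i hi => hpath i (by omega)))
      (by intro i j _ h; simp [eb] at h) (by norm_num) (by simp)
      ⟨1, by simp, hpath 0 (by omega)⟩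
    have := List.all_eq_true.1 h2 D hD
    simp only [Bool.and_eq_true, beq_iff_eq, List.all_eq_true, decide_eq_true_eq] at this
    exact ⟨D, this.1, this.2, hd⟩
  rcases hmk with ⟨rfl, rfl⟩ | ⟨rfl, rfl⟩ | ⟨rfl, rfl⟩
  · exact key _ _ cert7_ok ds7_ok
  · exact key _ _ cert10_ok ds10_ok
  · exact key _ _ cert13_ok ds13_ok

end Reed

open SimpleGraph Set

set_option linter.unusedSectionVars false
set_option linter.unusedSimpArgs false
namespace Reed

section Basics
variable {V : Type*} [Fintype V] [DecidableEq V] (G : SimpleGraph V)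

/-- `x` has a neighbour outside the path `l`. -/
def Out (l : List V) (x : V) : Prop := ∃ y, G.Adj x y ∧ y ∉ l

def hOut (l : List V) : Prop := ∃ x, l.head? = some x ∧ Out G l x

def lOut (l : List V) : Prop := ∃ x, l.getLast? = some x ∧ Out G l x

def IsEnd (l : List V) (x : V) : Prop := l.head? = some x ∨ l.getLast? = some x

def only4 (l : List V) : Prop :=
  l.length = 4 ∧ ∃ y, ∀ x z, IsEnd l x → G.Adj x z → z ∉ l → z = y

open Classical in
noncomputable def pen0 (l : List V) : ℕ :=
  if hOut G l then (if lOut G l then 0 else 1) else (if lOut G l then 1 else 3)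

open Classical in
noncomputable def pen (l : List V) : ℕ := 2 * pen0 G l + if only4 G l then 1 else 0

def fW (B n : ℕ) : ℕ := if n % 3 = 0 then 2 * n else if n % 3 = 1 then 4 * B + n else 3 * B

noncomputable def wt (l : List V) : ℕ := 16 * fW (2 * Fintype.card V + 1) l.length + pen G l

def Cover (S : Multiset (List V)) : Prop :=
  (∀ l ∈ S, l.IsChain G.Adj) ∧ (S.map (Multiset.ofList (α := V))).sum = Finset.univ.val

def Opt (S : Multiset (List V)) : Prop :=
  Cover G S ∧ ∀ T, Cover G T → (S.map (wt G)).sum ≤ (T.map (wt G)).sum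

variable {G}

theorem pen0_le (l : List V) : pen0 G l ≤ 3 := by
  unfold pen0; split_ifs <;> omega

theorem pen_le (l : List V) : pen G l ≤ 7 := by
  have := pen0_le (G := G) l
  unfold pen; split_ifs <;> omega

theorem exists_opt : ∃ S, Opt G S := by
  classical
  have hc : Cover G ((Finset.univ.val : Multiset V).map (fun v => [v])) := by
    constructor
    · intro l hl
      obtain ⟨v, -, rfl⟩ := Multiset.mem_map.1 hl
      exact List.isChain_singleton v
    · rw [Multiset.map_map]
      simp
  have hex : ∃ n, ∃ S, Cover G S ∧ (S.map (wt G)).sum = n := ⟨_, _, hc, rfl⟩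
  obtain ⟨S, hS, hn⟩ := Nat.find_spec hex
  refine ⟨S, hS, fun T hT => ?_⟩
  rw [hn]
  exact Nat.find_min' hex ⟨T, hT, rfl⟩

theorem Opt.chain {S : Multiset (List V)} (h : Opt G S) {P : List V} (hP : P ∈ S) :
    P.IsChain G.Adj := h.1.1 P hP

theorem Cover.nodup {P : List V} {R : Multiset (List V)} (h : Cover G (P ::ₘ R)) : P.Nodup := by
  have h2 := h.2
  rw [Multiset.map_cons, Multiset.sum_cons] at h2
  have : (P : Multiset V) ≤ Finset.univ.val := by rw [← h2]; exact Multiset.le_add_right _ _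
  exact Multiset.coe_nodup.1 (Multiset.nodup_of_le this Finset.univ.nodup)

theorem Opt.nodup {S : Multiset (List V)} (h : Opt G S) {P : List V} (hP : P ∈ S) : P.Nodup := by
  obtain ⟨R, rfl⟩ := Multiset.exists_cons_of_mem hP
  exact h.1.nodup

theorem Opt.length_le {S : Multiset (List V)} (h : Opt G S) {P : List V} (hP : P ∈ S) :
    P.length ≤ Fintype.card V := (h.nodup hP).length_le_card

theorem Cover.disjoint2 {P P' : List V} {R : Multiset (List V)} (h : Cover G (P ::ₘ P' ::ₘ R)) :
    ∀ y ∈ P, y ∉ P' := by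
  have h2 := h.2
  rw [Multiset.map_cons, Multiset.sum_cons, Multiset.map_cons, Multiset.sum_cons, ← add_assoc] at h2
  have h3 : (P : Multiset V) + (P' : Multiset V) ≤ Finset.univ.val := by rw [← h2]; exact Multiset.le_add_right _ _
  have h4 := Multiset.nodup_of_le h3 Finset.univ.nodup
  intro y h5 h6
  rw [Multiset.coe_add, Multiset.coe_nodup] at h4
  exact (List.nodup_append.1 h4).2.2 y h5 y h6 rfl

theorem two_mem {α : Type*} {S : Multiset α} {P P' : α} (hP : P ∈ S) (hP' : P' ∈ S) (hne : P ≠ P') :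
    ∃ R, S = P ::ₘ P' ::ₘ R := by
  obtain ⟨R, rfl⟩ := Multiset.exists_cons_of_mem hP
  have : P' ∈ R := by
    rcases Multiset.mem_cons.1 hP' with h | h
    · exact absurd h.symm hne
    · exact h
  obtain ⟨R', rfl⟩ := Multiset.exists_cons_of_mem this
  exact ⟨R', rfl⟩

theorem Opt.eq_of_mem {S : Multiset (List V)} (h : Opt G S) {P P' : List V} (hP : P ∈ S)
    (hP' : P' ∈ S) {y : V} (hy : y ∈ P) (hy' : y ∈ P') : P = P' := by
  by_contra hne
  obtain ⟨R, rfl⟩ := two_mem hP hP' hne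
  exact h.1.disjoint2 y hy hy'

theorem Opt.exists_mem {S : Multiset (List V)} (h : Opt G S) (y : V) : ∃ P ∈ S, y ∈ P := by
  have : y ∈ (S.map (Multiset.ofList (α := V))).sum := by rw [h.1.2]; simp
  
  have gen : ∀ T : Multiset (List V), y ∈ (T.map (Multiset.ofList (α := V))).sum →
      ∃ P ∈ T, y ∈ P := by
    intro T
    induction T using Multiset.induction_on with
    | empty => simp
    | cons a T ih =>
      rw [Multiset.map_cons, Multiset.sum_cons, Multiset.mem_add]
      rintro (h | h)
      · exact ⟨a, by simp, by simpa using h⟩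
      · obtain ⟨P, hP, hy⟩ := ih h
        exact ⟨P, by simp [hP], hy⟩
  exact gen S this

theorem Opt.swap2 {P P' Q Q' : List V} {R : Multiset (List V)} (h : Opt G (P ::ₘ P' ::ₘ R))
    (hQ : Q.IsChain G.Adj) (hQ' : Q'.IsChain G.Adj) (hp : (Q ++ Q').Perm (P ++ P')) :
    wt G P + wt G P' ≤ wt G Q + wt G Q' ∧
    (wt G Q + wt G Q' ≤ wt G P + wt G P' → Opt G (Q ::ₘ Q' ::ₘ R)) := by
  have hc : Cover G (Q ::ₘ Q' ::ₘ R) := by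
    constructor
    · intro l hl
      rcases Multiset.mem_cons.1 hl with rfl | hl
      · exact hQ
      rcases Multiset.mem_cons.1 hl with rfl | hl
      · exact hQ'
      exact h.1.1 l (by simp [hl])
    · rw [← h.1.2]
      simp only [Multiset.map_cons, Multiset.sum_cons, ← add_assoc, Multiset.coe_add]
      rw [Multiset.coe_eq_coe.2 hp]
  have h1 := h.2 _ hc
  simp only [Multiset.map_cons, Multiset.sum_cons, ← add_assoc] at h1
  refine ⟨by omega, fun hle => ⟨hc, fun T hT => le_trans ?_ (h.2 T hT)⟩⟩
  simp only [Multiset.map_cons, Multiset.sum_cons, ← add_assoc]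
  omega

theorem Opt.swap1 {P Q : List V} {R : Multiset (List V)} (h : Opt G (P ::ₘ R))
    (hQ : Q.IsChain G.Adj) (hp : Q.Perm P) :
    pen G P ≤ pen G Q ∧ (pen G Q ≤ pen G P → Opt G (Q ::ₘ R)) := by
  have hc : Cover G (Q ::ₘ R) := by
    constructor
    · intro l hl
      rcases Multiset.mem_cons.1 hl with rfl | hl
      · exact hQ
      exact h.1.1 l (by simp [hl])
    · rw [← h.1.2]
      simp only [Multiset.map_cons, Multiset.sum_cons]
      rw [Multiset.coe_eq_coe.2 hp]
  have h1 := h.2 _ hc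
  simp only [Multiset.map_cons, Multiset.sum_cons] at h1
  have hw : wt G Q + pen G P = wt G P + pen G Q := by
    unfold wt; rw [hp.length_eq]; omega
  refine ⟨by omega, fun hle => ⟨hc, fun T hT => le_trans ?_ (h.2 T hT)⟩⟩
  simp only [Multiset.map_cons, Multiset.sum_cons]
  omega

theorem Out.congr {l l' : List V} (h : l.Perm l') {x : V} : Out G l x ↔ Out G l' x := by
  unfold Out; simp [h.mem_iff]

theorem hOut_reverse (l : List V) : hOut G l.reverse ↔ lOut G l := by
  unfold hOut lOut
  simp [Out.congr (G := G) (List.reverse_perm l)]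

theorem lOut_reverse (l : List V) : lOut G l.reverse ↔ hOut G l := by
  unfold hOut lOut
  simp [Out.congr (G := G) (List.reverse_perm l)]

theorem isEnd_reverse (l : List V) (x : V) : IsEnd l.reverse x ↔ IsEnd l x := by
  unfold IsEnd; simp [or_comm]

theorem pen_reverse (l : List V) : pen G l.reverse = pen G l := by
  have h : only4 G l.reverse ↔ only4 G l := by
    unfold only4; simp [isEnd_reverse]
  unfold pen pen0
  have h1 := hOut_reverse (G := G) l
  have h2 := lOut_reverse (G := G) l
  by_cases a1 : hOut G l <;> by_cases a2 : lOut G l <;> by_cases a3 : only4 G l <;>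
    simp [a1, a2, a3, h, h1, h2]

theorem chain_reverse {l : List V} (h : l.IsChain G.Adj) : l.reverse.IsChain G.Adj := by
  rw [List.isChain_reverse]
  exact h.imp (fun a b hab => hab.symm)

theorem Opt.rev {P : List V} {R : Multiset (List V)} (h : Opt G (P ::ₘ R)) :
    Opt G (P.reverse ::ₘ R) :=
  (h.swap1 (chain_reverse (h.chain (Multiset.mem_cons_self _ _))) (List.reverse_perm P)).2
    (pen_reverse P).le

theorem IsEnd.mem {l : List V} {x : V} (h : IsEnd l x) : x ∈ l := by
  rcases h with h | h
  · exact List.mem_of_head? h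
  · exact List.mem_of_getLast? h

theorem chain_append {P Q : List V} (hP : P.IsChain G.Adj) (hQ : Q.IsChain G.Adj)
    (h : ∀ x, P.getLast? = some x → ∀ y, Q.head? = some y → G.Adj x y) :
    (P ++ Q).IsChain G.Adj := by
  rw [List.isChain_append]
  exact ⟨hP, hQ, fun x hx y hy => h x hx y hy⟩

/-- the key swapping lemma -/
theorem K_aux (B p a b : ℕ) (hB : 2 * (p + a + b + 1) + 1 ≤ B) (hp : p % 3 ≠ 0)
    (h1 : fW B p + fW B (a + 1 + b) ≤ fW B (p + 1 + b) + fW B a)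
    (h2 : fW B p + fW B (a + 1 + b) ≤ fW B (p + 1 + a) + fW B b) :
    (a % 3 = 1 ∧ b % 3 = 1) ∨ (a % 3 = 2 ∧ b % 3 = 2) := by
  unfold fW at h1 h2
  have ha : a % 3 < 3 := Nat.mod_lt _ (by norm_num)
  have hb : b % 3 < 3 := Nat.mod_lt _ (by norm_num)
  have hp' : p % 3 < 3 := Nat.mod_lt _ (by norm_num)
  have e1 : (a + 1 + b) % 3 = (a % 3 + 1 + b % 3) % 3 := by omega
  have e2 : (p + 1 + b) % 3 = (p % 3 + 1 + b % 3) % 3 := by omega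
  have e3 : (p + 1 + a) % 3 = (p % 3 + 1 + a % 3) % 3 := by omega
  rw [e1, e2] at h1
  rw [e1, e3] at h2
  generalize a % 3 = a' at *
  generalize b % 3 = b' at *
  generalize p % 3 = p' at *
  interval_cases p' <;> interval_cases a' <;> interval_cases b' <;> simp at * <;> omega

/-- the last-oriented version of `P` at end `x`. -/
theorem orient {P : List V} {x : V} (hP : P.IsChain G.Adj) (hx : IsEnd P x) :
    ∃ P0 : List V, P0.IsChain G.Adj ∧ P0.Perm P ∧ P0.getLast? = some x ∧ (P0 = P ∨ P0 = P.reverse) := by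
  rcases hx with hx | hx
  · exact ⟨P.reverse, chain_reverse hP, List.reverse_perm P, by simpa using hx, Or.inr rfl⟩
  · exact ⟨P, hP, List.Perm.refl _, hx, Or.inl rfl⟩

theorem chain_glue {P0 B : List V} {x y : V} (hP : P0.IsChain G.Adj) (hx : P0.getLast? = some x)
    (hxy : G.Adj x y) (hB : (y :: B).IsChain G.Adj) : (P0 ++ y :: B).IsChain G.Adj := by
  apply chain_append hP hB
  intro a ha b hb
  simp at hb
  rw [hx] at ha
  simp at ha
  rw [← ha, ← hb]; exact hxy

theorem chain_left {A B : List V} (h : (A ++ B).IsChain G.Adj) : A.IsChain G.Adj :=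
  (List.isChain_append.1 h).1

theorem chain_right {A B : List V} (h : (A ++ B).IsChain G.Adj) : B.IsChain G.Adj :=
  (List.isChain_append.1 h).2.1

theorem chain_rev_mid {A B : List V} {y : V} (h : (A ++ y :: B).IsChain G.Adj) :
    (y :: A.reverse).IsChain G.Adj := by
  have : (A ++ [y]).IsChain G.Adj := by
    apply chain_left (B := B); simpa using h
  simpa using chain_reverse this

theorem swap_perm1 {P0 P A B : List V} {y : V} (hp : P0.Perm P) :
    ((P0 ++ y :: B) ++ A).Perm (P ++ (A ++ y :: B)) := by
  rw [List.append_assoc]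
  exact hp.append List.perm_append_comm

theorem swap_perm2 {P0 P A B : List V} {y : V} (hp : P0.Perm P) :
    ((P0 ++ y :: A.reverse) ++ B).Perm (P ++ (A ++ y :: B)) := by
  rw [List.append_assoc]
  refine hp.append ?_
  have h1 : (y :: A.reverse ++ B).Perm (y :: (A ++ B)) := by
    simpa using (List.reverse_perm A).append_right B
  exact h1.trans List.perm_middle.symm

theorem K {S : Multiset (List V)} (h : Opt G S) {P P' : List V} (hP : P ∈ S) (hP' : P' ∈ S)
    (hne : P ≠ P') (h3 : P.length % 3 ≠ 0) {x y : V} (hx : IsEnd P x) (hxy : G.Adj x y)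
    {A B : List V} (hAB : P' = A ++ y :: B) :
    (A.length % 3 = 1 ∧ B.length % 3 = 1) ∨ (A.length % 3 = 2 ∧ B.length % 3 = 2) := by
  obtain ⟨R, rfl⟩ := two_mem hP hP' hne
  obtain ⟨P0, hc, hp, hl, -⟩ := orient (h.chain hP) hx
  have hcP' := h.chain hP'
  subst hAB
  have s1 := (h.swap2 (chain_glue hc hl hxy (chain_right hcP')) (chain_left hcP')
    (swap_perm1 hp)).1
  have s2 := (h.swap2 (chain_glue hc hl hxy (chain_rev_mid hcP')) 
    (chain_right (A := A ++ [y]) (by simpa using hcP')) (swap_perm2 hp)).1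
  have hcard : P.length + A.length + B.length + 1 ≤ Fintype.card V := by
    have h2 := h.1.2
    simp only [Multiset.map_cons, Multiset.sum_cons] at h2
    have := congrArg Multiset.card h2
    simp at this
    omega
  have q1 := pen_le (G := G) (P0 ++ y :: B)
  have q2 := pen_le (G := G) A
  have q3 := pen_le (G := G) (P0 ++ y :: A.reverse)
  have q4 := pen_le (G := G) B
  unfold wt at s1 s2
  have l1 := hp.length_eq
  simp only [List.length_append, List.length_cons, List.length_reverse, l1] at s1 s2
  apply K_aux (2 * Fintype.card V + 1) P.length A.length B.length (by omega) h3
  · rw [show A.length + 1 + B.length = A.length + (B.length + 1) by omega,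
      show P.length + 1 + B.length = P.length + (B.length + 1) by omega]
    omega
  · rw [show A.length + 1 + B.length = A.length + (B.length + 1) by omega,
      show P.length + 1 + A.length = P.length + (A.length + 1) by omega]
    omega

end Basics
end Reed

open SimpleGraph Set

set_option linter.unusedSectionVars false
set_option linter.unusedSimpArgs false
namespace Reed

section Tri
variable {V : Type*} [Fintype V] [DecidableEq V] (G : SimpleGraph V)

/-- `v` is dominated by `D`. -/
def dm (D : Finset V) (v : V) : Prop := ∃ d ∈ D, d = v ∨ G.Adj d v

variable {G}

theorem dm.mono {D D' : Finset V} (h : D ⊆ D') {v : V} (hv : dm G D v) : dm G D' v := by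
  obtain ⟨d, hd, h'⟩ := hv
  exact ⟨d, h hd, h'⟩

theorem dm_self {D : Finset V} {v : V} (h : v ∈ D) : dm G D v := ⟨v, h, Or.inl rfl⟩

theorem dm_adj {D : Finset V} {v w : V} (h : w ∈ D) (h' : G.Adj w v) : dm G D v :=
  ⟨w, h, Or.inr h'⟩

/-- middle vertices of consecutive triples -/
def tri : List V → List V
  | _ :: b :: _ :: t => b :: tri t
  | _ => []

theorem tri_length : ∀ l : List V, (tri l).length = l.length / 3
  | [] => by simp [tri]
  | [_] => by simp [tri]
  | [_, _] => by simp [tri]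
  | a :: b :: c :: t => by simp [tri, tri_length t]; omega

theorem tri_dom : ∀ l : List V, l.IsChain G.Adj → l.length % 3 = 0 →
    ∀ v ∈ l, ∃ d ∈ tri l, d = v ∨ G.Adj d v
  | [], _, _ => by simp
  | [_], _, h => by simp at h
  | [_, _], _, h => by simp at h
  | a :: b :: c :: t, hc, h => by
    intro v hv
    simp only [List.isChain_cons_cons] at hc
    simp only [List.mem_cons] at hv
    rw [tri]
    rcases hv with rfl | rfl | rfl | hv
    · exact ⟨b, by simp, Or.inr hc.1.symm⟩
    · exact ⟨v, by simp, Or.inl rfl⟩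
    · exact ⟨b, by simp, Or.inr hc.2.1⟩
    · obtain ⟨d, hd, h'⟩ := tri_dom t hc.2.2.tail (by simp at h; omega) v hv
      exact ⟨d, by simp [hd], h'⟩

theorem tri_app : ∀ (t : List V) (z : V), t.length % 3 = 0 → tri (t ++ [z]) = tri t
  | [], _, _ => by simp [tri]
  | [_], _, h => by simp at h
  | [_, _], _, h => by simp at h
  | a :: b :: c :: t, z, h => by
    simp only [List.cons_append, tri]
    rw [tri_app t z (by simp at h; omega)]

theorem tri_mem : ∀ (A : List V) (y : V) (B : List V), A.length % 3 = 1 → B ≠ [] →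
    y ∈ tri (A ++ y :: B)
  | [], _, _, h, _ => by simp at h
  | [a], y, [], _, h => by simp at h
  | [a], y, b :: B, _, _ => by simp [tri]
  | [_, _], _, _, h, _ => by simp at h
  | a :: b :: c :: A, y, B, h, hB => by
    simp only [List.cons_append, tri]
    exact List.mem_cons_of_mem _ (tri_mem A y B (by simp at h; omega) hB)

theorem core0 {P : List V} (hc : P.IsChain G.Adj) (h : P.length % 3 = 0) :
    ∃ D : Finset V, D.card ≤ P.length / 3 ∧
      (∀ A y B, P = A ++ y :: B → A.length % 3 = 1 → B.length % 3 = 1 → y ∈ D) ∧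
      ∀ v ∈ P, dm G D v := by
  refine ⟨(tri P).toFinset, ?_, ?_, ?_⟩
  · rw [← tri_length]; exact List.toFinset_card_le _
  · rintro A y B rfl hA hB
    rw [List.mem_toFinset]
    apply tri_mem A y B hA
    rintro rfl; simp at hB
  · intro v hv
    obtain ⟨d, hd, h'⟩ := tri_dom P hc h v hv
    exact ⟨d, by simpa using hd, h'⟩

theorem core1 {P : List V} (hc : P.IsChain G.Adj) (h : P.length % 3 = 1) {x : V} (hx : IsEnd P x) :
    ∃ D : Finset V, D.card ≤ P.length / 3 ∧ ∀ v ∈ P, v ≠ x → dm G D v := by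
  obtain ⟨P0, hc0, hp, hl, -⟩ := orient hc hx
  obtain ⟨t, rfl⟩ : ∃ t, P0 = t ++ [x] := by
    obtain ⟨t, ht⟩ := List.getLast?_eq_some_iff.1 hl
    exact ⟨t, ht⟩
  have hlen := hp.length_eq
  simp at hlen
  refine ⟨(tri t).toFinset, ?_, ?_⟩
  · refine (List.toFinset_card_le _).trans ?_
    rw [tri_length]; omega
  · intro v hv hvx
    have : v ∈ t := by
      have := hp.mem_iff.2 hv
      simpa [hvx] using this
    obtain ⟨d, hd, h'⟩ := tri_dom t (chain_left hc0) (by omega) v this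
    exact ⟨d, by simpa using hd, h'⟩

theorem core2 {P : List V} (hc : P.IsChain G.Adj) (h : P.length % 3 = 2) :
    ∃ D : Finset V, D.card ≤ P.length / 3 ∧
      (∀ A y B, P = A ++ y :: B → A.length % 3 = 2 → B.length % 3 = 2 → y ∈ D) ∧
      ∀ v ∈ P, P.head? = some v ∨ P.getLast? = some v ∨ dm G D v := by
  match P, hc, h with
  | [], _, h => simp at h
  | v1 :: t, hc, h =>
    obtain ⟨s, z, rfl⟩ : ∃ s z, t = s ++ [z] := by
      rcases List.eq_nil_or_concat t with rfl | ⟨s, z, rfl⟩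
      · simp at h
      · exact ⟨s, z, by simp⟩
    simp at h
    refine ⟨(tri (s ++ [z])).toFinset, ?_, ?_, ?_⟩
    · refine (List.toFinset_card_le _).trans ?_
      rw [tri_length]; simp; omega
    · intro A y B hAB hA hB
      match A, hAB, hA with
      | [], _, hA => simp at hA
      | a :: A, hAB, hA =>
        simp at hAB
        rw [List.mem_toFinset, hAB.2]
        apply tri_mem A y B (by simp at hA; omega)
        rintro rfl; simp at hB
    · intro v hv
      rw [tri_app _ _ (by omega)]
      simp at hv
      rcases hv with rfl | hv | rfl
      · simp
      · right; right
        obtain ⟨d, hd, h'⟩ := tri_dom s (chain_left hc.tail) (by omega) v hv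
        exact ⟨d, by simpa using hd, h'⟩
      · right; left
        rw [← List.cons_append]; exact List.getLast?_concat

end Tri
end Reed

open SimpleGraph Set

set_option linter.unusedSectionVars false
set_option linter.unusedSimpArgs false
namespace Reed

section Rot
variable {V : Type*} [Fintype V] [DecidableEq V] (G : SimpleGraph V)

/-- `y` is adjacent to an end of a 1- or 2-path of `R`. -/
def AccR (R : Multiset (List V)) (y : V) : Prop :=
  ∃ P1 ∈ R, P1.length % 3 ≠ 0 ∧ ∃ x, IsEnd P1 x ∧ G.Adj x y

def Sav (R : Multiset (List V)) (P : List V) : Prop :=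
  ∃ D : Finset V, (∀ y ∈ P, AccR G R y → y ∈ D) ∧ (∀ v ∈ P, dm G D v) ∧ 3 * D.card ≤ P.length + 1

/-- minimum degree at least three -/
def Deg3 : Prop := ∀ v b1 b2 : V, ∃ z, G.Adj v z ∧ z ≠ b1 ∧ z ≠ b2

variable {G}

theorem Sav.perm {R : Multiset (List V)} {P Q : List V} (h : P.Perm Q) (hS : Sav G R P) :
    Sav G R Q := by
  obtain ⟨D, h1, h2, h3⟩ := hS
  exact ⟨D, fun y hy => h1 y (h.mem_iff.2 hy), fun y hy => h2 y (h.mem_iff.2 hy),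
    by rw [← h.length_eq]; exact h3⟩

theorem KR {R : Multiset (List V)} {P : List V} (h : Opt G (P ::ₘ R)) {y : V}
    (ha : AccR G R y) {A B : List V} (hAB : P = A ++ y :: B) :
    (A.length % 3 = 1 ∧ B.length % 3 = 1) ∨ (A.length % 3 = 2 ∧ B.length % 3 = 2) := by
  obtain ⟨P1, h1, h2, x, hx, hxy⟩ := ha
  have hne : P1 ≠ P := by
    rintro rfl
    obtain ⟨R', rfl⟩ := Multiset.exists_cons_of_mem h1
    exact h.1.disjoint2 x hx.mem hx.mem
  exact K h (Multiset.mem_cons_of_mem h1) (Multiset.mem_cons_self _ _) hne h2 hx hxy hAB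

theorem not_only4 {P : List V} (h : P.length ≠ 4) : ¬ only4 G P := fun h' => h h'.1

theorem pen_eq {P : List V} (h : P.length ≠ 4) : pen G P = 2 * pen0 G P := by
  simp [pen, not_only4 h]

theorem rot {R : Multiset (List V)} {A B : List V} {v u : V}
    (h : Opt G ((A ++ u :: B) ::ₘ R)) (hA : A.head? = some v) (hin : ¬ hOut G (A ++ u :: B))
    (hvu : G.Adj v u) (h4 : (A ++ u :: B).length ≠ 4) :
    Opt G ((A.reverse ++ u :: B) ::ₘ R) ∧ ¬ hOut G (A.reverse ++ u :: B) ∧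
      (A.reverse ++ u :: B).Perm (A ++ u :: B) := by
  have hp : (A.reverse ++ u :: B).Perm (A ++ u :: B) := (List.reverse_perm A).append_right _
  have hc := h.chain (Multiset.mem_cons_self _ _)
  have hc' : (A.reverse ++ u :: B).IsChain G.Adj :=
    chain_glue (chain_reverse (chain_left hc)) (by simpa using hA) hvu (chain_right hc)
  have hl : lOut G (A.reverse ++ u :: B) ↔ lOut G (A ++ u :: B) := by
    unfold lOut
    simp only [Out.congr hp, List.getLast?_append_cons]
  obtain ⟨s1, s2⟩ := h.swap1 hc' hp
  rw [pen_eq h4, pen_eq (by rw [hp.length_eq]; exact h4)] at s1 s2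
  unfold pen0 at s1 s2
  by_cases a1 : hOut G (A.reverse ++ u :: B) <;> by_cases a2 : lOut G (A ++ u :: B) <;>
    have a3 := a2 <;> rw [← hl] at a3 <;> simp [a1, a2, a3, hin] at s1 s2
  · exact ⟨s2, a1, hp⟩
  · exact ⟨s2, a1, hp⟩

theorem not_out_mem {P : List V} {v u : V} (h : ¬ Out G P v) (hvu : G.Adj v u) : u ∈ P := by
  by_contra hu
  exact h ⟨u, hvu, hu⟩

theorem sav_of_last {R : Multiset (List V)} {P : List V} (h : Opt G (P ::ₘ R))
    (h2 : P.length % 3 = 2) {v u : V} {A B : List V} (hv : P.head? = some v) (hvu : G.Adj v u)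
    (hAB : P = A ++ u :: B) (hA : A.length % 3 = 2) : Sav G R P := by
  obtain ⟨D, hD1, hD2, hD3⟩ := core2 (h.chain (Multiset.mem_cons_self _ _)) h2
  have hlen := congrArg List.length hAB
  simp at hlen
  have hu : u ∈ D := hD2 A u B hAB hA (by omega)
  obtain ⟨z, hz⟩ : ∃ z, P.getLast? = some z := by
    rw [hAB]; simp only [List.getLast?_append_cons]
    exact ⟨_, List.getLast?_eq_some_getLast (by simp)⟩
  refine ⟨insert z D, ?_, ?_, ?_⟩
  · intro y hy hacc
    obtain ⟨A', B', hAB'⟩ := List.append_of_mem hy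
    have hlen' := congrArg List.length hAB'
    simp at hlen'
    apply Finset.mem_insert_of_mem
    rcases KR h hacc hAB' with ⟨h3, h4⟩ | ⟨h3, h4⟩
    · omega
    · exact hD2 A' y B' hAB' h3 h4
  · intro w hw
    rcases hD3 w hw with h5 | h5 | h5
    · rw [hv] at h5
      obtain rfl : v = w := by simpa using h5
      exact dm_adj (Finset.mem_insert_of_mem hu) hvu.symm
    · rw [hz] at h5
      obtain rfl : z = w := by simpa using h5
      exact dm_self (Finset.mem_insert_self _ _)
    · exact h5.mono (Finset.subset_insert _ _)
  · have := Finset.card_insert_le z D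
    omega

theorem hOut_iff {P : List V} {v : V} (hv : P.head? = some v) : hOut G P ↔ Out G P v := by
  unfold hOut; simp [hv]

theorem sl_nbr {R : Multiset (List V)} {P : List V} (h : Opt G (P ::ₘ R))
    (h2 : P.length % 3 = 2) {v u y : V} {A B : List V} (hv : P.head? = some v) (hin : ¬ hOut G P)
    (hns : ¬ Sav G R P) (hAB : P = A ++ y :: B) (hacc : AccR G R y) (hvu : G.Adj v u) :
    ∃ A1 A2, A = A1 ++ u :: A2 ∧ A1.length % 3 ≠ 2 := by
  have hlen := congrArg List.length hAB
  simp at hlen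
  have hu : u ∈ P := not_out_mem (by rwa [hOut_iff hv] at hin) hvu
  have hr := KR h hacc hAB
  have hne : ∀ A1 A2, P = A1 ++ u :: A2 → A1.length % 3 ≠ 2 := fun A1 A2 h3 h4 =>
    hns (sav_of_last h h2 hv hvu h3 h4)
  have hu' := hu
  rw [hAB] at hu'
  rcases List.mem_append.1 hu' with hu' | hu'
  · obtain ⟨A1, A2, rfl⟩ := List.append_of_mem hu'
    exact ⟨A1, A2, rfl, hne A1 (A2 ++ y :: B) (by simp [hAB])⟩
  exfalso
  rcases List.mem_cons.1 hu' with rfl | hu'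
  · exact hne A B hAB (by omega)
  · obtain ⟨B1, B2, rfl⟩ := List.append_of_mem hu'
    have hAne : A ≠ [] := by
      rintro rfl; simp at hr
    obtain ⟨a, A', rfl⟩ := List.exists_cons_of_ne_nil hAne
    have hav : a = v := by rw [hAB] at hv; simpa using hv
    subst hav
    have hP' : P = (a :: A' ++ y :: B1) ++ u :: B2 := by simp [hAB]
    subst hP'
    obtain ⟨r1, -, -⟩ := rot (v := a) h (by simp) hin hvu (by omega)
    have := KR r1 hacc (A := B1.reverse) (B := (a :: A').reverse ++ u :: B2) (by simp)
    apply hne _ _ rfl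
    simp at this hlen hr h2 ⊢
    omega

theorem SL {R : Multiset (List V)} (hd : Deg3 G) {P : List V} (h : Opt G (P ::ₘ R))
    (h2 : P.length % 3 = 2) {y : V} {A B : List V} (hin : ¬ hOut G P)
    (hns : ¬ Sav G R P) (hAB : P = A ++ y :: B) (hacc : AccR G R y) : 8 ≤ A.length := by
  by_contra hlt
  have hlen := congrArg List.length hAB
  simp at hlen
  have hr := KR h hacc hAB
  have main2 : ∀ v1 v2 y B, P = v1 :: v2 :: y :: B → AccR G R y → False := by
    intro v1 v2 y B hP hacc
    obtain ⟨z, hz, hz1, -⟩ := hd v1 v2 v2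
    obtain ⟨A1, A2, hA, hA1⟩ := sl_nbr (A := [v1, v2]) (v := v1) h h2 (by simp [hP]) hin hns hP hacc hz
    have : z ∈ [v1, v2] := by rw [hA]; simp
    simp at this
    rcases this with rfl | rfl
    · exact G.irrefl hz
    · exact hz1 rfl
  have main5 : ∀ P, Opt G (P ::ₘ R) → P.length % 3 = 2 → ¬ hOut G P → ¬ Sav G R P →
      ∀ v1 v2 v3 v4 v5 y B, P = v1 :: v2 :: v3 :: v4 :: v5 :: y :: B → AccR G R y →
      G.Adj v1 v2 ∧ G.Adj v1 v4 ∧ G.Adj v1 v5 := by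
    intro P h h2 hin hns v1 v2 v3 v4 v5 y B hP hacc
    have key : ∀ z, G.Adj v1 z → z = v2 ∨ z = v4 ∨ z = v5 := by
      intro z hz
      obtain ⟨A1, A2, hA, hA1⟩ := sl_nbr (A := [v1, v2, v3, v4, v5]) (v := v1) h h2 (by simp [hP])
        hin hns hP hacc hz
      have hnd := h.1.nodup
      rw [hP] at hnd
      have hl := congrArg List.length hA
      simp at hl
      have hlA : A1.length < 5 := by omega
      have e : [v1, v2, v3, v4, v5][A1.length]? = some z := by rw [hA]; simp
      have hc5 : A1.length = 0 ∨ A1.length = 1 ∨ A1.length = 3 ∨ A1.length = 4 := by omega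
      rcases hc5 with h0 | h0 | h0 | h0 <;> rw [h0] at e <;> simp at e
      · subst e; exact absurd hz G.irrefl
      · exact Or.inl e.symm
      · exact Or.inr (Or.inl e.symm)
      · exact Or.inr (Or.inr e.symm)
    refine ⟨?_, ?_, ?_⟩
    · obtain ⟨z, hz, a1, a2⟩ := hd v1 v4 v5
      rcases key z hz with rfl | rfl | rfl <;> first | exact hz | exact absurd rfl a1 | exact absurd rfl a2
    · obtain ⟨z, hz, a1, a2⟩ := hd v1 v2 v5
      rcases key z hz with rfl | rfl | rfl <;> first | exact hz | exact absurd rfl a1 | exact absurd rfl a2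
    · obtain ⟨z, hz, a1, a2⟩ := hd v1 v2 v4
      rcases key z hz with rfl | rfl | rfl <;> first | exact hz | exact absurd rfl a1 | exact absurd rfl a2
  have hA25 : A.length = 2 ∨ A.length = 5 := by omega
  rcases hA25 with hA | hA
  · obtain ⟨v1, v2, rfl⟩ := List.length_eq_two.1 hA
    exact main2 v1 v2 y B hAB hacc
  · match A, hA with
    | [v1, v2, v3, v4, v5], _ =>
      simp only [List.cons_append, List.nil_append] at hAB
      subst hAB
      obtain ⟨-, a14, a15⟩ := main5 _ h h2 hin hns _ _ _ _ _ _ _ rfl hacc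
      have hl4 : (v1 :: v2 :: v3 :: v4 :: v5 :: y :: B).length ≠ 4 := by simp
      obtain ⟨r1, r2, r3⟩ := rot (A := [v1, v2, v3, v4]) (u := v5) (B := y :: B) h rfl hin a15 hl4
      obtain ⟨s1, s2, s3⟩ := rot (A := [v1, v2, v3]) (u := v4) (B := v5 :: y :: B) h rfl hin a14 hl4
      obtain ⟨t1, t2, t3⟩ := rot (A := [v4, v3, v2]) (u := v1) (B := v5 :: y :: B) r1 rfl r2 a14.symm
        (by simp)
      obtain ⟨-, a34, a35⟩ := main5 _ s1 (by rw [s3.length_eq]; exact h2) s2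
        (fun hh => hns (hh.perm s3)) _ _ _ _ _ _ _ rfl hacc
      obtain ⟨-, a24, a25⟩ := main5 _ t1 (by simp at h2 ⊢; omega) t2
        (fun hh => hns ((hh.perm t3).perm r3)) _ _ _ _ _ _ _ rfl hacc
      have hc := h.chain (Multiset.mem_cons_self _ _)
      simp only [List.isChain_cons_cons] at hc
      obtain ⟨c1, c2, c3, c4, c5, c6⟩ := hc
      have hcc : (v4 :: v5 :: y :: B).IsChain G.Adj := by
        simp only [List.isChain_cons_cons]; exact ⟨c4, c5, c6⟩
      simp at h2
      obtain ⟨D, hD1, hD2, hD3⟩ := core2 hcc (by simp; omega)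
      obtain ⟨z, hz⟩ : ∃ z, (v4 :: v5 :: y :: B).getLast? = some z :=
        ⟨_, List.getLast?_eq_some_getLast (by simp)⟩
      apply hns
      refine ⟨insert v5 (insert z D), ?_, ?_, ?_⟩
      · intro w hw hwa
        apply Finset.mem_insert_of_mem
        apply Finset.mem_insert_of_mem
        obtain ⟨A', B', hAB'⟩ := List.append_of_mem hw
        have hlen' := congrArg List.length hAB'
        simp at hlen'
        have hrr := KR h hwa hAB'
        match A', hAB', hlen', hrr with
        | [], _, _, hrr => simp at hrr
        | [_], _, hlen', hrr => simp at hrr hlen'; omega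
        | [a, b], hAB', _, _ => 
          exfalso; exact main2 a b w B' (by simpa using hAB') hwa
        | a :: b :: c :: A', hAB', hlen', hrr =>
          simp at hAB'
          obtain ⟨-, -, -, hAB'⟩ := hAB'
          simp at hrr hlen'
          exact hD2 A' w B' hAB' (by omega) (by omega)
      · intro w hw
        have hv5 : v5 ∈ insert v5 (insert z D) := Finset.mem_insert_self _ _
        simp only [List.mem_cons] at hw
        rcases hw with rfl | rfl | rfl | hw
        · exact dm_adj hv5 a15.symm
        · exact dm_adj hv5 a25.symm
        · exact dm_adj hv5 a35.symm
        · rcases hD3 w (by simpa using hw) with h5 | h5 | h5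
          · simp at h5; subst h5; exact dm_adj hv5 c4.symm
          · rw [hz] at h5; simp at h5; subst h5
            exact dm_self (by simp)
          · exact h5.mono (fun q hq => by simp [hq])
      · have i1 := Finset.card_insert_le z D
        have i2 := Finset.card_insert_le v5 (insert z D)
        simp at hD1 ⊢
        omega

theorem in_nbr (hd : Deg3 G) {P : List V} {x : V} (hx : ¬ Out G P x) (b1 b2 : V) :
    ∃ z ∈ P, G.Adj x z ∧ z ≠ b1 ∧ z ≠ b2 := by
  obtain ⟨z, hz, h1, h2⟩ := hd x b1 b2
  exact ⟨z, not_out_mem hx hz, hz, h1, h2⟩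

theorem O5a {R : Multiset (List V)} (hd : Deg3 G) {v1 v2 v3 v4 v5 : V}
    (h : Opt G ([v1, v2, v3, v4, v5] ::ₘ R)) (hin : ¬ hOut G [v1, v2, v3, v4, v5])
    (h13 : ¬ G.Adj v1 v3) :
    ∃ w ∈ [v1, v2, v3, v4, v5], (∀ y ∈ [v1, v2, v3, v4, v5], ¬ AccR G R y) ∧
      ∀ v ∈ [v1, v2, v3, v4, v5], w = v ∨ G.Adj w v := by
  have hc := h.chain (Multiset.mem_cons_self _ _)
  simp only [List.isChain_cons_cons] at hc
  obtain ⟨c1, c2, c3, c4, -⟩ := hc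
  have i1 := hin
  rw [hOut_iff (v := v1) rfl] at i1
  have a14 : G.Adj v1 v4 := by
    obtain ⟨z, hz, ha, b1, b2⟩ := in_nbr hd i1 v2 v5
    simp at hz
    rcases hz with rfl | rfl | rfl | rfl | rfl
    · exact absurd ha G.irrefl
    · exact absurd rfl b1
    · exact absurd ha h13
    · exact ha
    · exact absurd rfl b2
  have a15 : G.Adj v1 v5 := by
    obtain ⟨z, hz, ha, b1, b2⟩ := in_nbr hd i1 v2 v4
    simp at hz
    rcases hz with rfl | rfl | rfl | rfl | rfl
    · exact absurd ha G.irrefl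
    · exact absurd rfl b1
    · exact absurd ha h13
    · exact absurd rfl b2
    · exact ha
  obtain ⟨r1, r2, r3⟩ := rot (A := [v1, v2, v3, v4]) (u := v5) (B := []) h rfl hin a15 (by simp)
  obtain ⟨s1, s2, s3⟩ := rot (A := [v1, v2, v3]) (u := v4) (B := [v5]) h rfl hin a14 (by simp)
  obtain ⟨t1, t2, t3⟩ := rot (A := [v4, v3, v2]) (u := v1) (B := [v5]) r1 rfl r2 a14.symm (by simp)
  have i3 := s2
  rw [hOut_iff (v := v3) rfl, Out.congr s3] at i3
  have i2 := t2
  rw [hOut_iff (v := v2) rfl, Out.congr (t3.trans r3)] at i2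
  have a35 : G.Adj v3 v5 := by
    obtain ⟨z, hz, ha, b1, b2⟩ := in_nbr hd i3 v2 v4
    simp at hz
    rcases hz with rfl | rfl | rfl | rfl | rfl
    · exact absurd ha.symm h13
    · exact absurd rfl b1
    · exact absurd ha G.irrefl
    · exact absurd rfl b2
    · exact ha
  have a2 : G.Adj v2 v4 ∨ G.Adj v2 v5 := by
    obtain ⟨z, hz, ha, b1, b2⟩ := in_nbr hd i2 v1 v3
    simp at hz
    rcases hz with rfl | rfl | rfl | rfl | rfl
    · exact absurd rfl b1
    · exact absurd ha G.irrefl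
    · exact absurd rfl b2
    · exact Or.inl ha
    · exact Or.inr ha
  have hacc : ∀ y ∈ [v1, v2, v3, v4, v5], ¬ AccR G R y := by
    intro y hy ha
    simp at hy
    rcases hy with rfl | rfl | rfl | rfl | rfl
    · have := KR h ha (A := []) (B := [v2, v3, v4, v5]) rfl; simp at this
    · have := KR h ha (A := [v1]) (B := [v3, v4, v5]) rfl; simp at this
    · have := KR s1 ha (A := []) (B := [v2, v1, v4, v5]) rfl; simp at this
    · have := KR h ha (A := [v1, v2, v3]) (B := [v5]) rfl; simp at this
    · have := KR h ha (A := [v1, v2, v3, v4]) (B := []) rfl; simp at this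
  rcases a2 with a2 | a2
  · refine ⟨v4, by simp, hacc, ?_⟩
    intro v hv
    simp at hv
    rcases hv with rfl | rfl | rfl | rfl | rfl
    · exact Or.inr a14.symm
    · exact Or.inr a2.symm
    · exact Or.inr c3.symm
    · exact Or.inl rfl
    · exact Or.inr c4
  · refine ⟨v5, by simp, hacc, ?_⟩
    intro v hv
    simp at hv
    rcases hv with rfl | rfl | rfl | rfl | rfl
    · exact Or.inr a15.symm
    · exact Or.inr a2.symm
    · exact Or.inr a35.symm
    · exact Or.inr c4.symm
    · exact Or.inl rfl

theorem acc5 {R : Multiset (List V)} {v1 v2 v3 v4 v5 : V}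
    (h : Opt G ([v1, v2, v3, v4, v5] ::ₘ R)) : ∀ y ∈ [v1, v2, v3, v4, v5], AccR G R y → y = v3 := by
  intro y hy ha
  simp at hy
  rcases hy with rfl | rfl | rfl | rfl | rfl
  · have := KR h ha (A := []) (B := [v2, v3, v4, v5]) rfl; simp at this
  · have := KR h ha (A := [v1]) (B := [v3, v4, v5]) rfl; simp at this
  · rfl
  · have := KR h ha (A := [v1, v2, v3]) (B := [v5]) rfl; simp at this
  · have := KR h ha (A := [v1, v2, v3, v4]) (B := []) rfl; simp at this

/-- 5-vertex 2-path with an in-end -/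
theorem O5one {R : Multiset (List V)} (hd : Deg3 G) {P : List V}
    (h : Opt G (P ::ₘ R)) (h5 : P.length = 5) (hin : ¬ hOut G P) :
    ∃ w ∈ P, (∀ y ∈ P, AccR G R y → y = w) ∧
      ∀ v ∈ P, P.getLast? ≠ some v → w = v ∨ G.Adj w v := by
  match P, h5 with
  | [v1, v2, v3, v4, v5], _ =>
    by_cases h13 : G.Adj v1 v3
    · have hc := h.chain (Multiset.mem_cons_self _ _)
      simp only [List.isChain_cons_cons] at hc
      obtain ⟨c1, c2, c3, c4, -⟩ := hc
      refine ⟨v3, by simp, acc5 h, ?_⟩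
      intro v hv hl
      simp at hv hl
      rcases hv with rfl | rfl | rfl | rfl | rfl
      · exact Or.inr h13.symm
      · exact Or.inr c2.symm
      · exact Or.inl rfl
      · exact Or.inr c3
      · exact absurd rfl hl
    · obtain ⟨w, h1, h2, h3⟩ := O5a hd h hin h13
      exact ⟨w, h1, fun y hy ha => absurd ha (h2 y hy), fun v hv _ => h3 v hv⟩

theorem O5in {R : Multiset (List V)} (hd : Deg3 G) {P : List V}
    (h : Opt G (P ::ₘ R)) (h5 : P.length = 5) (hin : ¬ hOut G P) (hin' : ¬ lOut G P) :
    ∃ w ∈ P, (∀ y ∈ P, AccR G R y → y = w) ∧ ∀ v ∈ P, w = v ∨ G.Adj w v := by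
  match P, h5 with
  | [v1, v2, v3, v4, v5], _ =>
    have hc := h.chain (Multiset.mem_cons_self _ _)
    simp only [List.isChain_cons_cons] at hc
    obtain ⟨c1, c2, c3, c4, -⟩ := hc
    by_cases h13 : G.Adj v1 v3
    · by_cases h53 : G.Adj v5 v3
      · refine ⟨v3, by simp, acc5 h, ?_⟩
        intro v hv
        simp at hv
        rcases hv with rfl | rfl | rfl | rfl | rfl
        · exact Or.inr h13.symm
        · exact Or.inr c2.symm
        · exact Or.inl rfl
        · exact Or.inr c3
        · exact Or.inr h53.symm
      · have hr := h.rev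
        rw [← hOut_reverse] at hin'
        simp only [List.reverse_cons, List.reverse_nil, List.nil_append, List.cons_append] at hr hin'
        obtain ⟨w, h1, h2, h3⟩ := O5a hd hr hin' h53
        refine ⟨w, ?_, fun y hy ha => absurd ha (h2 y ?_), fun v hv => h3 v ?_⟩
        · simp at h1 ⊢; tauto
        · simp at hy ⊢; tauto
        · simp at hv ⊢; tauto
    · obtain ⟨w, h1, h2, h3⟩ := O5a hd h hin h13
      exact ⟨w, h1, fun y hy ha => absurd ha (h2 y hy), h3⟩

end Rot
end Reed

open SimpleGraph Set

set_option linter.unusedSectionVars false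
set_option linter.unusedSimpArgs false
namespace Reed

section LemB
variable {V : Type*} [Fintype V] [DecidableEq V] {G : SimpleGraph V}

theorem L1 {R : Multiset (List V)} (hd : Deg3 G) {P : List V} (h : Opt G (P ::ₘ R))
    (hm : P.length = 7 ∨ P.length = 10 ∨ P.length = 13) (h1 : ¬ hOut G P) (h2 : ¬ lOut G P) :
    ∃ D : Finset V, D.card ≤ P.length / 3 ∧ ∀ v ∈ P, dm G D v := by
  obtain ⟨x0, hx0⟩ : ∃ x0, x0 ∈ P := List.exists_mem_of_length_pos (by omega)
  set g : ℕ → V := fun i => P.getD i x0 with hg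
  have hgi : ∀ i (hi : i < P.length), g i = P[i] := by
    intro i hi; simp [hg, hi]
  have hgmem : ∀ v ∈ P, ∃ i < P.length, g i = v := by
    intro v hv
    obtain ⟨i, hi, rfl⟩ := List.getElem_of_mem hv
    exact ⟨i, hi, hgi i hi⟩
  have hmap : (List.range P.length).map g = P := by
    apply List.ext_getElem
    · simp
    · intro i h1 h2
      simp [hgi i h2]
  have hc := h.chain (Multiset.mem_cons_self _ _)
  have h4 : P.length ≠ 4 := by omega
  let H : ℕ → ℕ → Prop := fun i j => G.Adj (g i) (g j)
  obtain ⟨D, hD1, hD2, hD3⟩ := small_sound (H := H) (fun i j hij => hij.symm) (m := P.length)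
    (k := P.length / 3) (by omega) (by
      intro i hi
      have := List.isChain_iff_getElem.1 hc i hi
      show G.Adj (g i) (g (i + 1))
      rw [hgi i (by omega), hgi (i + 1) hi]; exact this) (by
      intro l hl hch x t hlx b1 b2
      have hQp : (l.map g).Perm P := by
        have := hl.map g
        rwa [hmap] at this
      have hQc : (l.map g).IsChain G.Adj := by
        rw [List.isChain_map]; exact hch
      have s1 := (h.swap1 hQc hQp).1
      rw [pen_eq h4, pen_eq (by rw [hQp.length_eq]; exact h4)] at s1
      have hin : ¬ hOut G (l.map g) := by
        intro hh
        unfold pen0 at s1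
        simp [h1, h2, hh] at s1
        split_ifs at s1 <;> omega
      rw [hOut_iff (v := g x) (by simp [hlx]), Out.congr hQp] at hin
      obtain ⟨z, hz, ha, hz1, hz2⟩ := in_nbr hd hin (g b1) (g b2)
      obtain ⟨i, hi, rfl⟩ := hgmem z hz
      refine ⟨i, hi, ?_, ?_, ?_, ha⟩
      · rintro rfl; exact G.irrefl ha
      · rintro rfl; exact hz1 rfl
      · rintro rfl; exact hz2 rfl)
  refine ⟨(D.map g).toFinset, ?_, ?_⟩
  · refine (List.toFinset_card_le _).trans ?_
    simp [hD1]
  · intro v hv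
    obtain ⟨i, hi, rfl⟩ := hgmem v hv
    obtain ⟨d, hd, h'⟩ := hD3 i hi
    refine ⟨g d, by simp; exact ⟨d, hd, rfl⟩, ?_⟩
    rcases h' with rfl | h'
    · exact Or.inl rfl
    · exact Or.inr h'

theorem isEnd4 {w1 w2 w3 w4 x : V} : IsEnd [w1, w2, w3, w4] x ↔ x = w1 ∨ x = w4 := by
  simp [IsEnd, eq_comm]

/-- an out-vertex -/
theorem O4aux {R : Multiset (List V)} {P Q : List V} (h : Opt G (P ::ₘ R))
    (hQ : Q.IsChain G.Adj) (hp : Q.Perm P) (hP : only4 G P) (h1 : hOut G Q) (h2 : lOut G Q) :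
    only4 G Q := by
  have s1 := (h.swap1 hQ hp).1
  by_contra h3
  unfold pen pen0 at s1
  simp [h1, h2, h3, hP] at s1

theorem O4 {R : Multiset (List V)} (hd : Deg3 G) {P : List V} (h : Opt G (P ::ₘ R))
    (h4 : P.length = 4) :
    (∃ w, ∀ v ∈ P, w = v ∨ G.Adj w v) ∨
    (∀ y, ∃ x z, IsEnd P x ∧ G.Adj x z ∧ z ∉ P ∧ z ≠ y) ∨
    (∃ y, y ∉ P ∧ (∀ v ∈ P, G.Adj y v) ∧ ∀ x z, IsEnd P x → G.Adj x z → z ∉ P → z = y) := by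
  match P, h4 with
  | [w1, w2, w3, w4], _ =>
    by_cases hdom : ∃ w, ∀ v ∈ [w1, w2, w3, w4], w = v ∨ G.Adj w v
    · exact Or.inl hdom
    right
    have hc := h.chain (Multiset.mem_cons_self _ _)
    simp only [List.isChain_cons_cons] at hc
    obtain ⟨c1, c2, c3, -⟩ := hc
    have h13 : ¬ G.Adj w1 w3 := by
      intro ha
      refine hdom ⟨w3, ?_⟩
      intro v hv
      simp at hv
      rcases hv with rfl | rfl | rfl | rfl
      · exact Or.inr ha.symm
      · exact Or.inr c2.symm
      · exact Or.inl rfl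
      · exact Or.inr c3
    have h24 : ¬ G.Adj w2 w4 := by
      intro ha
      refine hdom ⟨w2, ?_⟩
      intro v hv
      simp at hv
      rcases hv with rfl | rfl | rfl | rfl
      · exact Or.inr c1.symm
      · exact Or.inl rfl
      · exact Or.inr c2
      · exact Or.inr ha
    by_cases h2 : ∀ y, ∃ x z, IsEnd [w1, w2, w3, w4] x ∧ G.Adj x z ∧ z ∉ [w1, w2, w3, w4] ∧ z ≠ y
    · exact Or.inl h2
    right
    push Not at h2
    obtain ⟨y, hy⟩ := h2
    have a14 : G.Adj w1 w4 := by
      obtain ⟨z, hz, b1, b2⟩ := hd w1 w2 y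
      by_contra hc
      refine b2 (hy w1 z (isEnd4.2 (Or.inl rfl)) hz ?_)
      intro hm
      simp at hm
      rcases hm with rfl | rfl | rfl | rfl
      · exact G.irrefl hz
      · exact b1 rfl
      · exact h13 hz
      · exact hc hz
    have hwy : ∀ w a b, (∀ z, G.Adj w z → z ∈ [w1, w2, w3, w4] → z = a ∨ z = b) →
        (∀ z, G.Adj w z → z ∉ [w1, w2, w3, w4] → z = y) →
        G.Adj w y ∧ y ∉ [w1, w2, w3, w4] := by
      intro w a b k1 k2
      obtain ⟨z, hz, b1, b2⟩ := hd w a b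
      have hm : z ∉ [w1, w2, w3, w4] := by
        intro hm
        rcases k1 z hz hm with rfl | rfl
        · exact b1 rfl
        · exact b2 rfl
      have := k2 z hz hm
      subst this
      exact ⟨hz, hm⟩
    have n1 : ∀ z, G.Adj w1 z → z ∈ [w1, w2, w3, w4] → z = w2 ∨ z = w4 := by
      intro z hz hm
      simp at hm
      rcases hm with rfl | rfl | rfl | rfl
      · exact absurd hz G.irrefl
      · exact Or.inl rfl
      · exact absurd hz h13
      · exact Or.inr rfl
    have n4 : ∀ z, G.Adj w4 z → z ∈ [w1, w2, w3, w4] → z = w1 ∨ z = w3 := by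
      intro z hz hm
      simp at hm
      rcases hm with rfl | rfl | rfl | rfl
      · exact Or.inl rfl
      · exact absurd hz.symm h24
      · exact Or.inr rfl
      · exact absurd hz G.irrefl
    have n2 : ∀ z, G.Adj w2 z → z ∈ [w1, w2, w3, w4] → z = w1 ∨ z = w3 := by
      intro z hz hm
      simp at hm
      rcases hm with rfl | rfl | rfl | rfl
      · exact Or.inl rfl
      · exact absurd hz G.irrefl
      · exact Or.inr rfl
      · exact absurd hz h24
    have n3 : ∀ z, G.Adj w3 z → z ∈ [w1, w2, w3, w4] → z = w2 ∨ z = w4 := by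
      intro z hz hm
      simp at hm
      rcases hm with rfl | rfl | rfl | rfl
      · exact absurd hz.symm h13
      · exact Or.inl rfl
      · exact absurd hz G.irrefl
      · exact Or.inr rfl
    have outw : ∀ w a b, (∀ z, G.Adj w z → z ∈ [w1, w2, w3, w4] → z = a ∨ z = b) →
        Out G [w1, w2, w3, w4] w := by
      intro w a b k1
      obtain ⟨z, hz, b1, b2⟩ := hd w a b
      refine ⟨z, hz, fun hm => ?_⟩
      rcases k1 z hz hm with rfl | rfl
      · exact b1 rfl
      · exact b2 rfl
    obtain ⟨y1, hyP⟩ := hwy w1 _ _ n1 (fun z hz hm => hy w1 z (isEnd4.2 (Or.inl rfl)) hz hm)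
    obtain ⟨y4, -⟩ := hwy w4 _ _ n4 (fun z hz hm => hy w4 z (isEnd4.2 (Or.inr rfl)) hz hm)
    have hP4 : only4 G [w1, w2, w3, w4] := ⟨rfl, y, hy⟩
    -- rotation w2 w3 w4 w1
    have y2 : G.Adj w2 y := by
      have hp : [w2, w3, w4, w1].Perm [w1, w2, w3, w4] :=
        (List.perm_append_comm (l₁ := [w2, w3, w4]) (l₂ := [w1]))
      have hq : only4 G [w2, w3, w4, w1] := by
        apply O4aux h _ hp hP4
        · rw [hOut_iff (v := w2) rfl, Out.congr hp]; exact outw _ _ _ n2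
        · exact ⟨w1, rfl, by rw [Out.congr hp]; exact outw _ _ _ n1⟩
        · simp only [List.isChain_cons_cons]
          exact ⟨c2, c3, a14.symm, List.isChain_singleton _⟩
      obtain ⟨-, y', hy'⟩ := hq
      have e : y = y' := hy' w1 y (isEnd4.2 (Or.inr rfl)) y1 (by rw [hp.mem_iff]; exact hyP)
      exact (hwy w2 _ _ n2 (fun z hz hm => by
        rw [e]; exact hy' w2 z (isEnd4.2 (Or.inl rfl)) hz (by rw [hp.mem_iff]; exact hm))).1
    have y3 : G.Adj w3 y := by
      have hp : [w3, w2, w1, w4].Perm [w1, w2, w3, w4] :=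
        (List.reverse_perm [w1, w2, w3]).append_right [w4]
      have hq : only4 G [w3, w2, w1, w4] := by
        apply O4aux h _ hp hP4
        · rw [hOut_iff (v := w3) rfl, Out.congr hp]; exact outw _ _ _ n3
        · exact ⟨w4, rfl, by rw [Out.congr hp]; exact outw _ _ _ n4⟩
        · simp only [List.isChain_cons_cons]
          exact ⟨c2.symm, c1.symm, a14, List.isChain_singleton _⟩
      obtain ⟨-, y', hy'⟩ := hq
      have e : y = y' := hy' w4 y (isEnd4.2 (Or.inr rfl)) y4 (by rw [hp.mem_iff]; exact hyP)
      exact (hwy w3 _ _ n3 (fun z hz hm => by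
        rw [e]; exact hy' w3 z (isEnd4.2 (Or.inl rfl)) hz (by rw [hp.mem_iff]; exact hm))).1
    refine ⟨y, hyP, ?_, hy⟩
    intro v hv
    simp at hv
    rcases hv with rfl | rfl | rfl | rfl
    · exact y1.symm
    · exact y2.symm
    · exact y3.symm
    · exact y4.symm

variable (G) in
def Reach (S : Multiset (List V)) : ℕ → List V → Prop
  | 0, P => P ∈ S ∧ P.length % 3 = 2 ∧ ¬ hOut G P ∧ ¬ lOut G P
  | n + 1, P => P ∈ S ∧ P.length % 3 = 2 ∧ ¬ (hOut G P ∧ lOut G P) ∧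
      ∃ z y3 P3, IsEnd P z ∧ G.Adj z y3 ∧ y3 ∉ P ∧ y3 ∈ P3 ∧ Reach S n P3

theorem Reach.mem {S : Multiset (List V)} {n : ℕ} {P : List V} (h : Reach G S n P) : P ∈ S := by
  cases n with
  | zero => exact h.1
  | succ n => exact h.1

theorem Reach.two {S : Multiset (List V)} {n : ℕ} {P : List V} (h : Reach G S n P) :
    P.length % 3 = 2 := by
  cases n with
  | zero => exact h.2.1
  | succ n => exact h.2.1

theorem Reach.notBoth {S : Multiset (List V)} {n : ℕ} {P : List V} (h : Reach G S n P) :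
    ¬ (hOut G P ∧ lOut G P) := by
  cases n with
  | zero => exact fun h' => h.2.2.1 h'.1
  | succ n => exact h.2.2.1

theorem Reach.transport {P1 P2 Q Q' : List V} {R : Multiset (List V)}
    (hb : hOut G P1 ∧ lOut G P1) :
    ∀ {n : ℕ} {P : List V}, Reach G (P1 ::ₘ P2 ::ₘ R) n P →
      (∀ m ≤ n, ¬ Reach G (P1 ::ₘ P2 ::ₘ R) m P2) → P ∈ R ∧ Reach G (Q ::ₘ Q' ::ₘ R) n P := by
  intro n
  induction n with
  | zero =>
    intro P h hm
    have hR : P ∈ R := by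
      have := h.mem
      simp only [Multiset.mem_cons] at this
      rcases this with rfl | rfl | h'
      · exact absurd hb h.notBoth
      · exact absurd h (hm 0 le_rfl)
      · exact h'
    exact ⟨hR, by simp [hR], h.2⟩
  | succ n ih =>
    intro P h hm
    have hR : P ∈ R := by
      have := h.mem
      simp only [Multiset.mem_cons] at this
      rcases this with rfl | rfl | h'
      · exact absurd hb h.notBoth
      · exact absurd h (hm _ le_rfl)
      · exact h'
    obtain ⟨-, h2, h3, z, y3, P3, hz, ha, h4, h5, h6⟩ := h
    exact ⟨hR, by simp [hR], h2, h3, z, y3, P3, hz, ha, h4, h5,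
      (ih h6 (fun m hm' => hm m (by omega))).2⟩

theorem pen_both {P : List V} (h : P.length % 3 = 2) (h1 : hOut G P) (h2 : lOut G P) :
    pen G P = 0 := by
  rw [pen_eq (by omega)]; simp [pen0, h1, h2]

theorem pen_some {P : List V} (h : P.length % 3 = 2) (h1 : hOut G P ∨ lOut G P) :
    pen G P ≤ 2 := by
  rw [pen_eq (by omega)]; unfold pen0
  split_ifs <;> simp <;> tauto

theorem pen_inin {P : List V} (h : P.length % 3 = 2) (h1 : ¬ hOut G P) (h2 : ¬ lOut G P) :
    pen G P = 6 := by
  rw [pen_eq (by omega)]; simp [pen0, h1, h2]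

theorem pen_notBoth {P : List V} (h : P.length % 3 = 2) (h1 : ¬ (hOut G P ∧ lOut G P)) :
    2 ≤ pen G P := by
  rw [pen_eq (by omega)]; unfold pen0
  split_ifs <;> simp <;> tauto

theorem wt2 {P : List V} (h : P.length % 3 = 2) :
    wt G P = 48 * (2 * Fintype.card V + 1) + pen G P := by
  unfold wt fW; simp [h]; ring

/-- ends of `X` in `X ++ y :: Y`. -/
theorem lOut_left {X Y : List V} {y : V} (hc : (X ++ y :: Y).IsChain G.Adj)
    (hn : (X ++ y :: Y).Nodup) (hX : X ≠ []) : lOut G X := by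
  refine ⟨X.getLast hX, List.getLast?_eq_some_getLast hX, y, ?_, ?_⟩
  · exact (List.isChain_append.1 hc).2.2 _ (by simp [List.getLast?_eq_some_getLast hX]) y (by simp)
  · intro h
    exact (List.nodup_append.1 hn).2.2 y h y (by simp) rfl

theorem hOut_right {X Y : List V} {y : V} (hc : (X ++ y :: Y).IsChain G.Adj)
    (hn : (X ++ y :: Y).Nodup) (hY : Y ≠ []) : hOut G Y := by
  have h1 : (Y.reverse ++ y :: X.reverse).IsChain G.Adj := by simpa using chain_reverse hc
  have h2 : (Y.reverse ++ y :: X.reverse).Nodup := by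
    have := List.nodup_reverse.2 hn
    simpa using this
  have := lOut_left h1 h2 (by simpa using hY)
  rwa [lOut_reverse] at this

theorem LemB : ∀ (n : ℕ) (S : Multiset (List V)) (P1 P0 P2 : List V) (x x' y u : V),
    Opt G S → P1 ∈ S → P1.length % 3 = 2 → (P0 = P1 ∨ P0 = P1.reverse) → hOut G P1 → lOut G P1 →
    P0.head? = some x' → P0.getLast? = some x → G.Adj x y → y ∈ P2 → P2 ≠ P1 → Reach G S n P2 →
    G.Adj x' u → u ∉ P1 → u ≠ y → False := by
  intro n
  induction n using Nat.strong_induction_on with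
  | _ n IH =>
  intro S P1 P0 P2 x x' y u hS hP1 h12 hP0 hh1 hl1 hx' hx hxy hy hne hR hxu huP huy
  by_cases hmin : ∃ m < n, Reach G S m P2
  · obtain ⟨m, hm, hR'⟩ := hmin
    exact IH m hm S P1 P0 P2 x x' y u hS hP1 h12 hP0 hh1 hl1 hx' hx hxy hy hne hR' hxu huP huy
  push Not at hmin
  have hP2 := hR.mem
  have h22 := hR.two
  obtain ⟨R, rfl⟩ := two_mem hP1 hP2 hne.symm
  have hp0 : P0.Perm P1 := by
    rcases hP0 with rfl | rfl
    · exact List.Perm.refl _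
    · exact List.reverse_perm _
  have hc0 : P0.IsChain G.Adj := by
    rcases hP0 with rfl | rfl
    · exact hS.chain hP1
    · exact chain_reverse (hS.chain hP1)
  have hxe : IsEnd P1 x := by
    rcases hP0 with rfl | rfl
    · exact Or.inr hx
    · left; simpa using hx
  have hl0 := hp0.length_eq
  -- general decomposition facts
  have dec : ∀ P2' X Y : List V, P2'.IsChain G.Adj → P2'.Perm P2 → (P2' = P2 ∨ P2' = P2.reverse) →
      P2' = X ++ y :: Y → X.length % 3 = 2 ∧ Y.length % 3 = 2 := by
    intro P2' X Y hc hp hor hXY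
    have hlen := hp.length_eq
    rw [hXY] at hlen
    simp at hlen
    rcases hor with rfl | rfl
    · rcases K hS hP1 hP2 hne.symm (by omega) hxe hxy hXY with h | h
      · omega
      · exact h
    · have e : P2 = Y.reverse ++ y :: X.reverse := by
        have := congrArg List.reverse hXY
        simpa using this
      rcases K hS hP1 hP2 hne.symm (by omega) hxe hxy e with h | h
      · simp at h; omega
      · simp at h; exact ⟨h.2, h.1⟩
  have hn2 := hS.nodup hP2
  have hc2 := hS.chain hP2
  -- swap facts
  have sw : ∀ P2' X Y : List V, P2'.IsChain G.Adj → P2'.Perm P2 → (P2' = P2 ∨ P2' = P2.reverse) →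
      P2' = X ++ y :: Y → u ∉ Y →
      (P0 ++ y :: Y).length % 3 = 2 ∧ hOut G (P0 ++ y :: Y) ∧ X.length % 3 = 2 ∧ lOut G X ∧
      pen G P1 + pen G P2 ≤ pen G (P0 ++ y :: Y) + pen G X ∧
      (pen G (P0 ++ y :: Y) + pen G X ≤ pen G P1 + pen G P2 → 
        Opt G ((P0 ++ y :: Y) ::ₘ X ::ₘ R)) := by
    intro P2' X Y hc hp hor hXY hu
    obtain ⟨lX, lY⟩ := dec P2' X Y hc hp hor hXY
    have hnd : (X ++ y :: Y).Nodup := by rw [← hXY]; exact hp.nodup_iff.2 hn2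
    rw [hXY] at hc
    have q1 : (P0 ++ y :: Y).length % 3 = 2 := by simp; omega
    have s := hS.swap2 (chain_glue hc0 hx hxy (chain_right hc)) (chain_left hc)
      ((swap_perm1 hp0).trans ((List.Perm.refl P1).append (by rw [← hXY]; exact hp)))
    rw [wt2 h12, wt2 h22, wt2 q1, wt2 lX] at s
    refine ⟨q1, ⟨x', ?_, u, hxu, ?_⟩, lX, lOut_left hc hnd (by rintro rfl; simp at lX), by omega,
      fun h => s.2 (by omega)⟩
    · rw [List.head?_append, hx']; rfl
    · simp only [List.mem_append, List.mem_cons, not_or]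
      exact ⟨fun h => huP (hp0.mem_iff.1 h), huy, hu⟩
  have pP1 := pen_both h12 hh1 hl1
  cases n with
  | zero =>
    obtain ⟨X, Y, hXY⟩ := List.append_of_mem hy
    have pP2 := pen_inin h22 hR.2.2.1 hR.2.2.2
    have hnd := hn2
    rw [hXY] at hnd
    by_cases hu : u ∈ Y
    · have huX : u ∉ X.reverse := by
        rw [List.mem_reverse]
        intro h; exact (List.nodup_append.1 hnd).2.2 u h u (by simp [hu]) rfl
      obtain ⟨q1, q2, q3, q4, q5, -⟩ := sw P2.reverse Y.reverse X.reverse (chain_reverse hc2)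
        (List.reverse_perm _) (Or.inr rfl) (by simp [hXY]) huX
      have := pen_some q1 (Or.inl q2)
      have := pen_some q3 (Or.inr q4)
      omega
    · obtain ⟨q1, q2, q3, q4, q5, -⟩ := sw P2 X Y hc2
        (List.Perm.refl _) (Or.inl rfl) hXY hu
      have := pen_some q1 (Or.inl q2)
      have := pen_some q3 (Or.inr q4)
      omega
  | succ n =>
    obtain ⟨-, -, hnb, z, y3, P3, hz, hzy, hy3, hy3', hR3⟩ := hR
    have pP2 := pen_notBoth h22 hnb
    obtain ⟨hP3R, -⟩ := Reach.transport (Q := []) (Q' := []) ⟨hh1, hl1⟩ hR3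
      (fun m hm => hmin m (by omega))
    have tr : ∀ Q Q', Reach G (Q ::ₘ Q' ::ₘ R) n P3 := fun Q Q' =>
      (Reach.transport ⟨hh1, hl1⟩ hR3 (fun m hm => hmin m (by omega))).2
    have hy3P1 : y3 ∉ P1 := by
      intro h
      have := hS.eq_of_mem hP1 hR3.mem h hy3'
      subst this
      exact hR3.notBoth ⟨hh1, hl1⟩
    -- orient P2 with head z
    obtain ⟨P2', hc2', hp2', hor, hz'⟩ : ∃ P2' : List V, P2'.IsChain G.Adj ∧ P2'.Perm P2 ∧
        (P2' = P2 ∨ P2' = P2.reverse) ∧ P2'.head? = some z := by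
      rcases hz with hz | hz
      · exact ⟨P2, hc2, List.Perm.refl _, Or.inl rfl, hz⟩
      · exact ⟨P2.reverse, chain_reverse hc2, List.reverse_perm _, Or.inr rfl, by simpa using hz⟩
    obtain ⟨Z, Z', hZ⟩ := List.append_of_mem (hp2'.mem_iff.2 hy)
    obtain ⟨lZ, lZ'⟩ := dec P2' Z Z' hc2' hp2' hor hZ
    have hZne : Z ≠ [] := by rintro rfl; simp at lZ
    have hnd : (Z ++ y :: Z').Nodup := by rw [← hZ]; exact hp2'.nodup_iff.2 hn2
    have hzZ : Z.head? = some z := by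
      rw [hZ, List.head?_append_of_ne_nil _ hZne] at hz'; exact hz'
    have memZ : ∀ w, w ∈ Z → w ∈ P2 := fun w hw => hp2'.mem_iff.1 (by rw [hZ]; simp [hw])
    have hy3y : y ≠ y3 := by rintro rfl; exact hy3 hy
    by_cases hu : u ∈ Z'
    · have huZ : u ∉ Z.reverse := by
        rw [List.mem_reverse]
        intro h; exact (List.nodup_append.1 hnd).2.2 u h u (by simp [hu]) rfl
      obtain ⟨q1, q2, q3, q4, q5, q6⟩ := sw P2'.reverse Z'.reverse Z.reverse (chain_reverse hc2')
        ((List.reverse_perm _).trans hp2')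
        (by rcases hor with rfl | rfl
            · exact Or.inr rfl
            · left; simp) (by simp [hZ]) huZ
      have huP2 : u ∈ P2 := hp2'.mem_iff.1 (by rw [hZ]; simp [hu])
      have hy3Q : y3 ∉ P0 ++ y :: Z.reverse := by
        simp only [List.mem_append, List.mem_cons, not_or, List.mem_reverse]
        exact ⟨fun h => hy3P1 (hp0.mem_iff.1 h), hy3y.symm, fun h => hy3 (memZ _ h)⟩
      have hlast : (P0 ++ y :: Z.reverse).getLast? = some z := by
        rw [List.getLast?_append_cons, List.getLast?_cons]
        simp [hzZ]
      have hlo : lOut G (P0 ++ y :: Z.reverse) := ⟨z, hlast, y3, hzy, hy3Q⟩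
      have p1 := pen_both q1 q2 hlo
      have p2 := pen_some q3 (Or.inr q4)
      have hopt := q6 (by omega)
      refine IH n (by omega) _ (P0 ++ y :: Z.reverse) (P0 ++ y :: Z.reverse) P3 z x' y3 u hopt
        (by simp) q1 (Or.inl rfl) q2 hlo ?_ hlast hzy hy3' ?_ (tr _ _) hxu ?_ ?_
      · rw [List.head?_append, hx']; rfl
      · rintro rfl; exact hy3Q hy3'
      · simp only [List.mem_append, List.mem_cons, not_or]
        exact ⟨fun h => huP (hp0.mem_iff.1 h), huy, huZ⟩
      · rintro rfl; exact hy3 huP2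
    · obtain ⟨q1, q2, q3, q4, q5, q6⟩ := sw P2' Z Z' hc2' hp2' hor hZ hu
      have hhZ : hOut G Z := ⟨z, hzZ, y3, hzy, fun h => hy3 (memZ _ h)⟩
      have p1 := pen_both q3 hhZ q4
      have p2 := pen_some q1 (Or.inl q2)
      have hopt := q6 (by omega)
      obtain ⟨q, hq⟩ : ∃ q, Z.getLast? = some q := ⟨_, List.getLast?_eq_some_getLast hZne⟩
      have hqy : G.Adj q y := by
        rw [hZ] at hc2'
        exact (List.isChain_append.1 hc2').2.2 q (by simp [hq]) y (by simp)
      refine IH n (by omega) _ Z Z.reverse P3 z q y3 y hopt (by simp) q3 (Or.inr rfl) hhZ q4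
        (by simpa using hq) (by simpa using hzZ) hzy hy3' ?_ (tr _ _) hqy ?_ hy3y
      · rintro rfl; exact hy3 (memZ _ hy3')
      · intro h; exact (List.nodup_append.1 hnd).2.2 y h y (by simp) rfl

theorem LemB' {S : Multiset (List V)} (hS : Opt G S) {n : ℕ} {P1 P2 : List V} (hP1 : P1 ∈ S)
    (h12 : P1.length % 3 = 2) (hh : hOut G P1) (hl : lOut G P1) (hR : Reach G S n P2) {x y : V}
    (hx : IsEnd P1 x) (hxy : G.Adj x y) (hy : y ∈ P2) (hne : P2 ≠ P1) :
    ∀ x' u, IsEnd P1 x' → G.Adj x' u → u ∉ P1 → u = y := by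
  have key : ∀ P0, (P0 = P1 ∨ P0 = P1.reverse) → P0.getLast? = some x →
      ∀ x' u, IsEnd P1 x' → G.Adj x' u → u ∉ P1 → u = y := by
    intro P0 hP0 hx0
    have hne0 : P0 ≠ [] := by rintro rfl; simp at hx0
    obtain ⟨a, ha⟩ : ∃ a, P0.head? = some a := ⟨_, List.head?_eq_some_head hne0⟩
    have haEnd : ∀ x', IsEnd P1 x' → x' = a ∨ x' = x := by
      intro x' hx'
      have : IsEnd P0 x' := by
        rcases hP0 with rfl | rfl
        · exact hx'
        · rwa [isEnd_reverse]
      rcases this with h | h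
      · rw [ha] at h; left; simpa using h.symm
      · rw [hx0] at h; right; simpa using h.symm
    have ka : ∀ u, G.Adj a u → u ∉ P1 → u = y := by
      intro u hau hu
      by_contra hne'
      exact LemB n S P1 P0 P2 x a y u hS hP1 h12 hP0 hh hl ha hx0 hxy hy hne hR hau hu hne'
    have haout : Out G P1 a := by
      rcases hP0 with rfl | rfl
      · rwa [hOut_iff ha] at hh
      · obtain ⟨b, hb, hb'⟩ := hl
        have : b = a := by
          simp at ha
          rw [ha] at hb; simpa using hb.symm
        rwa [← this]
    obtain ⟨u, hau, huP⟩ := haout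
    have := ka u hau huP
    subst this
    have kx : ∀ w, G.Adj x w → w ∉ P1 → w = u := by
      intro w hxw hw
      by_contra hne'
      refine LemB n S P1 P0.reverse P2 a x u w hS hP1 h12 ?_ hh hl (by simpa using hx0)
        (by simpa using ha) hau hy hne hR hxw hw hne'
      rcases hP0 with rfl | rfl
      · exact Or.inr rfl
      · left; simp
    intro x' w hx' hw hwP
    rcases haEnd x' hx' with rfl | rfl
    · exact ka w hw hwP
    · exact kx w hw hwP
  rcases hx with hx | hx
  · exact key P1.reverse (Or.inr rfl) (by simpa using hx)
  · exact key P1 (Or.inl rfl) hx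

end LemB
end Reed

open SimpleGraph Set

set_option linter.unusedSectionVars false
set_option linter.unusedSimpArgs false
namespace Reed

section DeadSec
variable {V : Type*} [Fintype V] [DecidableEq V] (G : SimpleGraph V)

/-- savable inside the cover `S` -/
def SavS (S : Multiset (List V)) (P : List V) : Prop := Sav G (S.erase P) P

def NoDom (P : List V) : Prop := ¬ ∃ w, ∀ v ∈ P, w = v ∨ G.Adj w v

def Freer (S : Multiset (List V)) (P1 P2 : List V) : Prop :=
  P1 ∈ S ∧ P1 ≠ P2 ∧ ∃ y ∈ P2, (∀ x u, IsEnd P1 x → G.Adj x u → u ∉ P1 → u = y) ∧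
    ((P1.length % 3 = 2 ∧ 5 ≤ P1.length ∧ hOut G P1 ∧ lOut G P1) ∨
      (P1.length = 4 ∧ (∀ v ∈ P1, G.Adj y v) ∧ NoDom G P1))

def Freed (S : Multiset (List V)) (P2 : List V) : Prop :=
  P2 ∈ S ∧ P2.length % 3 = 2 ∧ ¬ SavS G S P2 ∧ ¬ (hOut G P2 ∧ lOut G P2) ∧ ∃ P1, Freer G S P1 P2

inductive Dead (S : Multiset (List V)) (Act : Finset (List V)) : List V → Prop
  | mk (P : List V) (hP : P ∈ S) (h2 : P.length % 3 = 2) (hs : ¬ SavS G S P) (hf : ¬ Freed G S P)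
    (ha : P ∉ Act)
    (hn : ∀ x y P', IsEnd P x → G.Adj x y → y ∉ P → P' ∈ S → y ∈ P' → Dead S Act P') :
    Dead S Act P

variable {G}

theorem Dead.out {S : Multiset (List V)} {Act : Finset (List V)} {P : List V} (h : Dead G S Act P) :
    P ∈ S ∧ P.length % 3 = 2 ∧ ¬ SavS G S P ∧ ¬ Freed G S P ∧ P ∉ Act ∧
    ∀ x y P', IsEnd P x → G.Adj x y → y ∉ P → P' ∈ S → y ∈ P' → Dead G S Act P' := by
  cases h with
  | mk _ h1 h2 h3 h4 h5 h6 => exact ⟨h1, h2, h3, h4, h5, h6⟩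

theorem Dead.anti {S : Multiset (List V)} {Act Act' : Finset (List V)} (hA : Act ⊆ Act')
    {P : List V} (h : Dead G S Act' P) : Dead G S Act P := by
  induction h with
  | mk P hP h2 hs hf ha hn ih => exact Dead.mk P hP h2 hs hf (fun h => ha (hA h)) ih

theorem mem_erase_of {S : Multiset (List V)} {P P' : List V} (h : P ∈ S) (hne : P ≠ P') :
    P ∈ S.erase P' := (Multiset.mem_erase_of_ne hne).2 h

theorem opt_erase {S : Multiset (List V)} (hS : Opt G S) {P : List V} (hP : P ∈ S) :
    Opt G (P ::ₘ S.erase P) := by rwa [Multiset.cons_erase hP]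

/-- order-2 ends have two outside neighbours -/
theorem two_two (hd : Deg3 G) {P : List V} (h2 : P.length = 2) (y : V) {x : V} (hx : IsEnd P x) :
    ∃ z, G.Adj x z ∧ z ∉ P ∧ z ≠ y := by
  match P, h2 with
  | [a, b], _ =>
    have hx' : x = a ∨ x = b := by simpa [IsEnd, eq_comm] using hx
    rcases hx' with rfl | rfl
    · obtain ⟨z, hz, h1, h2⟩ := hd x b y
      refine ⟨z, hz, ?_, h2⟩
      simp only [List.mem_cons, List.not_mem_nil, or_false, not_or]
      exact ⟨fun h => G.irrefl (h ▸ hz), h1⟩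
    · obtain ⟨z, hz, h1, h2⟩ := hd x a y
      refine ⟨z, hz, ?_, h2⟩
      simp only [List.mem_cons, List.not_mem_nil, or_false, not_or]
      exact ⟨h1, fun h => G.irrefl (h ▸ hz)⟩

theorem freed_of_reach (hd : Deg3 G) {S : Multiset (List V)} (hS : Opt G S) {n : ℕ}
    {P1 P2 : List V} (hP1 : P1 ∈ S) (h12 : P1.length % 3 = 2) (hh : hOut G P1) (hl : lOut G P1)
    (hR : Reach G S n P2) (hs : ¬ SavS G S P2) {x y : V}
    (hx : IsEnd P1 x) (hxy : G.Adj x y) (hy : y ∈ P2) (hne : P2 ≠ P1) : Freed G S P2 := by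
  have key := LemB' hS hP1 h12 hh hl hR hx hxy hy hne
  refine ⟨hR.mem, hR.two, hs, hR.notBoth, P1, hP1, hne.symm, y, hy, key, Or.inl ⟨h12, ?_, hh, hl⟩⟩
  by_contra h5
  obtain ⟨z, hz, hz1, hz2⟩ := two_two hd (P := P1) (by omega) y hx
  exact hz2 (key x z hx hz hz1)

theorem Dead.reach (hd : Deg3 G) {S : Multiset (List V)} (hS : Opt G S) {Act : Finset (List V)}
    {P : List V} (h : Dead G S Act P) : ∃ n, Reach G S n P := by
  induction h with
  | mk P hP h2 hs hf ha hn ih =>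
    have hout : ∀ x y, IsEnd P x → G.Adj x y → y ∉ P → ∃ P' n, y ∈ P' ∧ P' ≠ P ∧
        Dead G S Act P' ∧ Reach G S n P' := by
      intro x y hx hxy hy
      obtain ⟨P', hP', hy'⟩ := hS.exists_mem y
      obtain ⟨n, hn'⟩ := ih x y P' hx hxy hy hP' hy'
      exact ⟨P', n, hy', fun h => hy (h ▸ hy'), hn x y P' hx hxy hy hP' hy', hn'⟩
    by_cases hb : hOut G P ∧ lOut G P
    · exfalso
      obtain ⟨x, hx, y, hxy, hy⟩ := hb.1
      obtain ⟨P', n, hy', hne, hdd, hr⟩ := hout x y (Or.inl hx) hxy hy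
      have hdo := hdd.out
      exact hdo.2.2.2.1 (freed_of_reach hd hS hP h2 hb.1 hb.2 hr hdo.2.2.1 (Or.inl hx) hxy hy' hne)
    · by_cases h1 : hOut G P
      · obtain ⟨x, hx, y, hxy, hy⟩ := h1
        obtain ⟨P', n, hy', hne, hdd, hr⟩ := hout x y (Or.inl hx) hxy hy
        exact ⟨n + 1, hP, h2, hb, x, y, P', Or.inl hx, hxy, hy, hy', hr⟩
      · by_cases h3 : lOut G P
        · obtain ⟨x, hx, y, hxy, hy⟩ := h3
          obtain ⟨P', n, hy', hne, hdd, hr⟩ := hout x y (Or.inr hx) hxy hy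
          exact ⟨n + 1, hP, h2, hb, x, y, P', Or.inr hx, hxy, hy, hy', hr⟩
        · exact ⟨0, hP, h2, h1, h3⟩

theorem Dead.notBoth (hd : Deg3 G) {S : Multiset (List V)} (hS : Opt G S) {Act : Finset (List V)}
    {P : List V} (h : Dead G S Act P) : ¬ (hOut G P ∧ lOut G P) := by
  obtain ⟨n, hn⟩ := h.reach hd hS
  exact hn.notBoth

theorem both_not_dead (hd : Deg3 G) {S : Multiset (List V)} (hS : Opt G S) {Act : Finset (List V)}
    {P1 P2 : List V} (hP1 : P1 ∈ S) (h12 : P1.length % 3 = 2) (hh : hOut G P1) (hl : lOut G P1)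
    {x y : V} (hx : IsEnd P1 x) (hxy : G.Adj x y) (hy : y ∈ P2) (hne : P2 ≠ P1) :
    ¬ Dead G S Act P2 := by
  intro hdd
  obtain ⟨n, hn⟩ := hdd.reach hd hS
  have hdo := hdd.out
  exact hdo.2.2.2.1 (freed_of_reach hd hS hP1 h12 hh hl hn hdo.2.2.1 hx hxy hy hne)

theorem Dead.root {S : Multiset (List V)} (hS : Opt G S) {Act : Finset (List V)}
    {P : List V} (h : Dead G S Act P) :
    ∃ r, Dead G S Act r ∧ ¬ hOut G r ∧ ¬ lOut G r ∧ ∀ Act', Dead G S Act' P → Dead G S Act' r := by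
  induction h with
  | mk P hP h2 hs hf ha hn ih =>
    have hout : ∀ x y, IsEnd P x → G.Adj x y → y ∉ P → ∃ r, Dead G S Act r ∧ ¬ hOut G r ∧
        ¬ lOut G r ∧ ∀ Act', Dead G S Act' P → Dead G S Act' r := by
      intro x y hx hxy hy
      obtain ⟨P', hP', hy'⟩ := hS.exists_mem y
      obtain ⟨r, h1, h2, h3, h4⟩ := ih x y P' hx hxy hy hP' hy'
      exact ⟨r, h1, h2, h3, fun Act' hA => h4 Act' (hA.out.2.2.2.2.2 x y P' hx hxy hy hP' hy')⟩
    by_cases h1 : hOut G P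
    · obtain ⟨x, hx, y, hxy, hy⟩ := h1
      exact hout x y (Or.inl hx) hxy hy
    · by_cases h3 : lOut G P
      · obtain ⟨x, hx, y, hxy, hy⟩ := h3
        exact hout x y (Or.inr hx) hxy hy
      · exact ⟨P, Dead.mk P hP h2 hs hf ha hn, h1, h3, fun _ h => h⟩

theorem naive2 {P : List V} (hc : P.IsChain G.Adj) (h2 : P.length % 3 = 2) :
    ∃ D : Finset V, D.card ≤ P.length / 3 + 1 ∧ ∀ v ∈ P, dm G D v := by
  match P, hc, h2 with
  | [], _, h => simp at h
  | [_], _, h => simp at h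
  | a :: b :: t, hc, h =>
    simp only [List.isChain_cons_cons] at hc
    simp at h
    obtain ⟨D, hD1, hD2⟩ := core1 (x := b) hc.2 (by simp; omega) (Or.inl rfl)
    refine ⟨insert a D, ?_, ?_⟩
    · have := Finset.card_insert_le a D
      simp at hD1 ⊢; omega
    · intro v hv
      have ha : a ∈ insert a D := Finset.mem_insert_self _ _
      rcases List.mem_cons.1 hv with rfl | hv
      · exact dm_self ha
      · by_cases hvb : v = b
        · subst hvb; exact dm_adj ha hc.1
        · exact (hD2 v hv hvb).mono (Finset.subset_insert _ _)

open Classical in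
variable (G) in
/-- the accepted vertices of `P`. -/
noncomputable def accF (S : Multiset (List V)) (P : List V) : Finset V :=
  P.toFinset.filter (fun y => AccR G (S.erase P) y)

theorem mem_accF {S : Multiset (List V)} {P : List V} {y : V} :
    y ∈ accF G S P ↔ y ∈ P ∧ AccR G (S.erase P) y := by
  unfold accF; simp

theorem accF_pos {S : Multiset (List V)} (hS : Opt G S) {P : List V} (hP : P ∈ S)
    (h2 : P.length % 3 = 2) (hs : ¬ SavS G S P) : (accF G S P).Nonempty := by
  by_contra hne
  apply hs
  obtain ⟨D, hD1, hD2⟩ := naive2 (hS.chain hP) h2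
  refine ⟨D, ?_, hD2, by omega⟩
  intro y hy ha
  exact absurd ⟨y, mem_accF.2 ⟨hy, ha⟩⟩ hne

theorem idx_split {P : List V} {y : V} (hy : y ∈ P) :
    ∃ A B, P = A ++ y :: B ∧ A.length = P.idxOf y := by
  refine ⟨P.take (P.idxOf y), P.drop (P.idxOf y + 1), ?_, ?_⟩
  · have hlt := List.idxOf_lt_length_of_mem hy
    conv_lhs => rw [← List.take_append_drop (P.idxOf y) P]
    rw [List.drop_eq_getElem_cons hlt]
    simp
  · have hlt := List.idxOf_lt_length_of_mem hy
    simp; omega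

theorem SLrev (hd : Deg3 G) {R : Multiset (List V)} {P : List V} (h : Opt G (P ::ₘ R))
    (h2 : P.length % 3 = 2) {y : V} {A B : List V} (hin : ¬ lOut G P)
    (hns : ¬ Sav G R P) (hAB : P = A ++ y :: B) (hacc : AccR G R y) : 8 ≤ B.length := by
  have := SL hd h.rev (A := B.reverse) (B := A.reverse) (y := y) (by simpa using h2)
    (by rwa [hOut_reverse]) (fun hh => hns (hh.perm (List.reverse_perm _))) (by simp [hAB]) hacc
  simpa using this

theorem card_acc_aux {P : List V} {T : Finset V} {a b : ℕ}
    (hT : ∀ y ∈ T, y ∈ P ∧ P.idxOf y % 3 = 2 ∧ a ≤ P.idxOf y / 3 ∧ P.idxOf y / 3 < b) :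
    T.card ≤ b - a := by
  have : T.card ≤ (Finset.Ico a b).card := by
    apply Finset.card_le_card_of_injOn (fun y => P.idxOf y / 3)
    · intro y hy
      have := hT y hy
      simp; omega
    · intro y hy z hz hyz
      have h1 := hT y hy
      have h2 := hT z hz
      simp at hyz
      have : P.idxOf y = P.idxOf z := by omega
      exact (List.idxOf_inj h1.1).1 this
  simpa using this

theorem acc_one (hd : Deg3 G) {S : Multiset (List V)} (hS : Opt G S) {P : List V} (hP : P ∈ S)
    (h2 : P.length % 3 = 2) (hs : ¬ SavS G S P) (hb : ¬ (hOut G P ∧ lOut G P)) :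
    (accF G S P).card + 2 ≤ P.length / 3 := by
  have hopt := opt_erase hS hP
  have hpos := accF_pos hS hP h2 hs
  have hpos' := Finset.card_pos.2 hpos
  by_cases h1 : hOut G P
  · have h3 : ¬ lOut G P := fun h => hb ⟨h1, h⟩
    have := card_acc_aux (P := P) (T := accF G S P) (a := 0) (b := P.length / 3 - 2) (by
      intro y hy
      obtain ⟨hyP, hya⟩ := mem_accF.1 hy
      obtain ⟨A, B, hAB, hA⟩ := idx_split hyP
      have hlen := congrArg List.length hAB
      simp at hlen
      have k := KR hopt hya hAB
      have s := SLrev hd hopt h2 h3 hs hAB hya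
      refine ⟨hyP, ?_, ?_, ?_⟩ <;> omega)
    omega
  · have := card_acc_aux (P := P) (T := accF G S P) (a := 2) (b := P.length / 3) (by
      intro y hy
      obtain ⟨hyP, hya⟩ := mem_accF.1 hy
      obtain ⟨A, B, hAB, hA⟩ := idx_split hyP
      have hlen := congrArg List.length hAB
      simp at hlen
      have k := KR hopt hya hAB
      have s := SL hd hopt h2 h1 hs hAB hya
      refine ⟨hyP, ?_, ?_, ?_⟩ <;> omega)
    omega

theorem acc_in (hd : Deg3 G) {S : Multiset (List V)} (hS : Opt G S) {P : List V} (hP : P ∈ S)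
    (h2 : P.length % 3 = 2) (hs : ¬ SavS G S P) (h1 : ¬ hOut G P) (h3 : ¬ lOut G P) :
    (accF G S P).card + 4 ≤ P.length / 3 := by
  have hopt := opt_erase hS hP
  have hpos := accF_pos hS hP h2 hs
  have hpos' := Finset.card_pos.2 hpos
  have := card_acc_aux (P := P) (T := accF G S P) (a := 2) (b := P.length / 3 - 2) (by
      intro y hy
      obtain ⟨hyP, hya⟩ := mem_accF.1 hy
      obtain ⟨A, B, hAB, hA⟩ := idx_split hyP
      have hlen := congrArg List.length hAB
      simp at hlen
      have k := KR hopt hya hAB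
      have s := SL hd hopt h2 h1 hs hAB hya
      have s' := SLrev hd hopt h2 h3 hs hAB hya
      refine ⟨hyP, ?_, ?_, ?_⟩ <;> omega)
  omega

variable (G) in
def Dem (S : Multiset (List V)) (P : List V) : Prop :=
  P ∈ S ∧ (hOut G P ∨ lOut G P) ∧
    ((P.length % 3 = 1 ∧ P.length ≤ 13 ∧ (P.length = 4 → NoDom G P)) ∨
      (P.length = 5 ∧ ¬ (hOut G P ∧ lOut G P)))

variable (G) in
def Served (S : Multiset (List V)) (Act : Finset (List V)) (P : List V) : Prop :=
  ∃ x y P', IsEnd P x ∧ G.Adj x y ∧ y ∉ P ∧ P' ∈ S ∧ y ∈ P' ∧ ¬ Dead G S Act P'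

theorem Served.mono {S : Multiset (List V)} {Act Act' : Finset (List V)} (h : Act ⊆ Act')
    {P : List V} (hs : Served G S Act P) : Served G S Act' P := by
  obtain ⟨x, y, P', h1, h2, h3, h4, h5, h6⟩ := hs
  exact ⟨x, y, P', h1, h2, h3, h4, h5, fun hd => h6 (hd.anti h)⟩

open Classical in
variable (G) in
noncomputable def supp (S : Multiset (List V)) (Act : Finset (List V)) (δ : List V) :
    Finset (List V) :=
  S.toFinset.filter (fun q => Dead G S Act q ∧
    ∀ Act', Act ⊆ Act' → ¬ Dead G S Act' q → Served G S Act' δ)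

theorem mem_supp {S : Multiset (List V)} {Act : Finset (List V)} {δ q : List V} :
    q ∈ supp G S Act δ ↔ Dead G S Act q ∧
      ∀ Act', Act ⊆ Act' → ¬ Dead G S Act' q → Served G S Act' δ := by
  unfold supp
  simp only [Finset.mem_filter, Multiset.mem_toFinset, and_iff_right_iff_imp]
  exact fun h => h.1.out.1

open Classical in
variable (G) in
/-- outside neighbours of the ends -/
noncomputable def outN (P : List V) : Finset V :=
  Finset.univ.filter (fun y => y ∉ P ∧ ∃ x, IsEnd P x ∧ G.Adj x y)

theorem mem_outN {P : List V} {y : V} :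
    y ∈ outN G P ↔ y ∉ P ∧ ∃ x, IsEnd P x ∧ G.Adj x y := by
  unfold outN; simp

theorem supp_of_nbr {S : Multiset (List V)} {Act : Finset (List V)} {δ : List V}
    (hu : ¬ Served G S Act δ) {x y : V} (hx : IsEnd δ x) (hxy : G.Adj x y) (hy : y ∉ δ)
    {P' : List V} (hP' : P' ∈ S) (hy' : y ∈ P') : P' ∈ supp G S Act δ := by
  rw [mem_supp]
  constructor
  · by_contra h
    exact hu ⟨x, y, P', hx, hxy, hy, hP', hy', h⟩
  · intro Act' _ h
    exact ⟨x, y, P', hx, hxy, hy, hP', hy', h⟩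

theorem supp_sum (hd : Deg3 G) {S : Multiset (List V)} (hS : Opt G S) {Act : Finset (List V)}
    {δ : List V} (hδ : Dem G S δ) (hu : ¬ Served G S Act δ) :
    2 + ((outN G δ).card : ℤ) ≤ ∑ q ∈ supp G S Act δ, (((q.length / 3 : ℕ) : ℤ) - 2) := by
  classical
  have hδ3 : δ.length % 3 ≠ 0 := by
    rcases hδ.2.2 with h | h <;> omega
  -- a root in the support
  obtain ⟨r, hr, hr1, hr2⟩ : ∃ r ∈ supp G S Act δ, ¬ hOut G r ∧ ¬ lOut G r := by
    obtain ⟨x, y, hx, hxy, hy⟩ : ∃ x y, IsEnd δ x ∧ G.Adj x y ∧ y ∉ δ := by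
      rcases hδ.2.1 with ⟨x, hx, y, h1, h2⟩ | ⟨x, hx, y, h1, h2⟩
      · exact ⟨x, y, Or.inl hx, h1, h2⟩
      · exact ⟨x, y, Or.inr hx, h1, h2⟩
    obtain ⟨P', hP', hy'⟩ := hS.exists_mem y
    have hq := mem_supp.1 (supp_of_nbr hu hx hxy hy hP' hy')
    obtain ⟨r, r1, r2, r3, r4⟩ := hq.1.root hS
    exact ⟨r, mem_supp.2 ⟨r1, fun Act' hA hn => hq.2 Act' hA (fun h => hn (r4 Act' h))⟩, r2, r3⟩
  have hbd : ∀ q ∈ supp G S Act δ, ((accF G S q).card : ℤ) + (if q = r then 2 else 0) ≤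
      ((q.length / 3 : ℕ) : ℤ) - 2 := by
    intro q hq
    have hdq := (mem_supp.1 hq).1
    have ho := hdq.out
    split_ifs with hqr
    · subst hqr
      have := acc_in hd hS ho.1 ho.2.1 ho.2.2.1 hr1 hr2
      omega
    · have := acc_one hd hS ho.1 ho.2.1 ho.2.2.1 (hdq.notBoth hd hS)
      omega
  have hcov : outN G δ ⊆ (supp G S Act δ).biUnion (fun q => accF G S q) := by
    intro y hy
    obtain ⟨hyδ, x, hx, hxy⟩ := mem_outN.1 hy
    obtain ⟨P', hP', hy'⟩ := hS.exists_mem y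
    rw [Finset.mem_biUnion]
    refine ⟨P', supp_of_nbr hu hx hxy hyδ hP' hy', mem_accF.2 ⟨hy', δ, ?_, hδ3, x, hx, hxy⟩⟩
    exact mem_erase_of hδ.1 (fun h => hyδ (h ▸ hy'))
  have hc := (Finset.card_le_card hcov).trans Finset.card_biUnion_le
  have hs := Finset.sum_le_sum hbd
  rw [Finset.sum_add_distrib, Finset.sum_ite_eq' (supp G S Act δ) r (fun _ => (2 : ℤ))] at hs
  simp only [hr, if_true] at hs
  have : ((outN G δ).card : ℤ) ≤ ∑ q ∈ supp G S Act δ, ((accF G S q).card : ℤ) := by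
    exact_mod_cast hc
  linarith

/-- the deficit of an unserved demander is covered by its support -/
theorem need_le (hd : Deg3 G) {S : Multiset (List V)} (hS : Opt G S) {Act : Finset (List V)}
    {δ : List V} (hδ : Dem G S δ) (hu : ¬ Served G S Act δ) :
    8 * ((δ.length / 3 : ℕ) + 1 : ℤ) - 3 * (δ.length : ℤ) ≤
      ∑ q ∈ supp G S Act δ, (((q.length / 3 : ℕ) : ℤ) - 2) := by
  have hsum := supp_sum hd hS hδ hu
  generalize (∑ q ∈ supp G S Act δ, (((q.length / 3 : ℕ) : ℤ) - 2)) = X at hsum ⊢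
  have hpos : 1 ≤ (outN G δ).card := by
    rw [Nat.one_le_iff_ne_zero, ← Nat.pos_iff_ne_zero, Finset.card_pos]
    rcases hδ.2.1 with ⟨x, hx, y, h1, h2⟩ | ⟨x, hx, y, h1, h2⟩
    · exact ⟨y, mem_outN.2 ⟨h2, x, Or.inl hx, h1⟩⟩
    · exact ⟨y, mem_outN.2 ⟨h2, x, Or.inr hx, h1⟩⟩
  rcases hδ.2.2 with ⟨h1, h13, h4⟩ | ⟨h5, -⟩
  · by_cases hl1 : δ.length = 1
    · have h3 : 3 ≤ (outN G δ).card := by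
        match δ, hl1 with
        | [x], _ =>
          have hmem : ∀ z, G.Adj x z → z ∈ outN G [x] := by
            intro z hz
            refine mem_outN.2 ⟨?_, x, Or.inl rfl, hz⟩
            simp only [List.mem_singleton]
            rintro rfl; exact G.irrefl hz
          obtain ⟨a, ha, -, -⟩ := hd x x x
          obtain ⟨b, hb, hba, -⟩ := hd x a a
          obtain ⟨c, hc, hca, hcb⟩ := hd x a b
          have hsub : ({a, b, c} : Finset V) ⊆ outN G [x] := by
            intro z hz
            simp only [Finset.mem_insert, Finset.mem_singleton] at hz
            rcases hz with rfl | rfl | rfl <;> apply hmem <;> assumption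
          have := Finset.card_le_card hsub
          rwa [Finset.card_eq_three.2 ⟨a, b, c, hba.symm, hca.symm, hcb.symm, rfl⟩] at this
      have e : δ.length / 3 = 0 := by omega
      rw [e, hl1]
      push_cast
      omega
    · by_cases hl4 : δ.length = 4
      · have h2 : 2 ≤ (outN G δ).card := by
          rcases O4 hd (opt_erase hS hδ.1) hl4 with h | h | ⟨y, hyP, hyd, hyu⟩
          · exact absurd h (h4 hl4)
          · obtain ⟨z1, hz1⟩ := Finset.card_pos.1 hpos
            obtain ⟨x, z, hx, hxz, hz, hne⟩ := h z1
            exact Finset.one_lt_card.2 ⟨z, mem_outN.2 ⟨hz, x, hx, hxz⟩, z1, hz1, hne⟩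
          · exfalso
            obtain ⟨P', hP', hy'⟩ := hS.exists_mem y
            obtain ⟨z1, hz1⟩ := Finset.card_pos.1 hpos
            obtain ⟨hz1', x, hx, hxz⟩ := mem_outN.1 hz1
            have hzy := hyu x z1 hx hxz hz1'
            subst hzy
            have hD := (mem_supp.1 (supp_of_nbr hu hx hxz hz1' hP' hy')).1
            have ho := hD.out
            exact ho.2.2.2.1 ⟨hP', ho.2.1, ho.2.2.1, hD.notBoth hd hS, δ, hδ.1,
              fun e => hz1' (e ▸ hy'), z1, hy', hyu, Or.inr ⟨hl4, hyd, h4 hl4⟩⟩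
        have e : δ.length / 3 = 1 := by omega
        rw [e, hl4]
        push_cast
        omega
      · omega
  · omega

end DeadSec
end Reed

open SimpleGraph Set

set_option linter.unusedSectionVars false
set_option linter.unusedSimpArgs false
namespace Reed

section AsgSec
variable {V : Type*} [Fintype V] [DecidableEq V] (G : SimpleGraph V)

/-- `v` is dominated by an accepted vertex of a path that is not dead -/
def Cov (S : Multiset (List V)) (Act : Finset (List V)) (v : V) : Prop :=
  ∃ P' ∈ S, ∃ y ∈ P', G.Adj y v ∧ AccR G (S.erase P') y ∧ ¬ Dead G S Act P'

def Asg (S : Multiset (List V)) (Act : Finset (List V)) (P : List V) (D : Finset V) : Prop :=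
  (¬ Dead G S Act P → ∀ y ∈ P, AccR G (S.erase P) y → y ∈ D) ∧
    ∀ v ∈ P, dm G D v ∨ Cov G S Act v

def IsFreer (S : Multiset (List V)) (P : List V) : Prop :=
  ∃ P2, Freed G S P2 ∧ Freer G S P P2

variable {G}

theorem cov_of {S : Multiset (List V)} {Act : Finset (List V)} {P P' : List V} (hP : P ∈ S)
    (h3 : P.length % 3 ≠ 0) {x y : V} (hx : IsEnd P x) (hxy : G.Adj x y) (hy : y ∉ P)
    (hP' : P' ∈ S) (hy' : y ∈ P') (hnd : ¬ Dead G S Act P') : Cov G S Act x :=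
  ⟨P', hP', y, hy', hxy.symm, ⟨P, mem_erase_of hP (fun h => hy (h ▸ hy')), h3, x, hx, hxy⟩, hnd⟩

theorem noacc1 {S : Multiset (List V)} (hS : Opt G S) {P : List V} (hP : P ∈ S)
    (h1 : P.length % 3 = 1) {y : V} (hy : y ∈ P) : ¬ AccR G (S.erase P) y := by
  intro ha
  obtain ⟨A, B, hAB, -⟩ := idx_split hy
  have := KR (opt_erase hS hP) ha hAB
  have hl := congrArg List.length hAB
  simp at hl
  omega

theorem asg0 {S : Multiset (List V)} (hS : Opt G S) {Act : Finset (List V)} {P : List V}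
    (hP : P ∈ S) (h0 : P.length % 3 = 0) : ∃ D, Asg G S Act P D ∧ D.card ≤ P.length / 3 := by
  obtain ⟨D, h1, h2, h3⟩ := core0 (hS.chain hP) h0
  refine ⟨D, ⟨fun _ y hy ha => ?_, fun v hv => Or.inl (h3 v hv)⟩, h1⟩
  obtain ⟨A, B, hAB, -⟩ := idx_split hy
  have := KR (opt_erase hS hP) ha hAB
  have hl := congrArg List.length hAB
  simp at hl
  exact h2 A y B hAB (by omega) (by omega)

theorem asg1_freer {S : Multiset (List V)} (hS : Opt G S) {Act : Finset (List V)} {P : List V}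
    (hP : P ∈ S) (h1 : P.length % 3 = 1) (hf : IsFreer G S P) :
    P.length = 4 ∧ Asg G S Act P ∅ := by
  obtain ⟨P2, hP2, -, hne, y, hy, hyu, h | ⟨h4, hya, -⟩⟩ := hf
  · omega
  refine ⟨h4, fun _ y hy ha => absurd ha (noacc1 hS hP h1 hy), fun v hv => Or.inr ?_⟩
  have hnd : ¬ Dead G S Act P2 := fun hd => hd.out.2.2.2.1 hP2
  have hx : IsEnd P (P.head (by rintro rfl; simp at h4)) := Or.inl (List.head?_eq_some_head _)
  exact ⟨P2, hP2.1, y, hy, hya v hv,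
    ⟨P, mem_erase_of hP hne, by omega, _, hx, (hya _ hx.mem).symm⟩, hnd⟩

theorem asg1_served {S : Multiset (List V)} (hS : Opt G S) {Act : Finset (List V)} {P : List V}
    (hP : P ∈ S) (h1 : P.length % 3 = 1) (hs : Served G S Act P) :
    ∃ D, Asg G S Act P D ∧ D.card ≤ P.length / 3 := by
  obtain ⟨x, y, P', hx, hxy, hy, hP', hy', hnd⟩ := hs
  obtain ⟨D, hD1, hD2⟩ := core1 (hS.chain hP) h1 hx
  refine ⟨D, ⟨fun _ y hy ha => absurd ha (noacc1 hS hP h1 hy), fun v hv => ?_⟩, hD1⟩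
  by_cases hvx : v = x
  · subst hvx
    exact Or.inr (cov_of hP (by omega) hx hxy hy hP' hy' hnd)
  · exact Or.inl (hD2 v hv hvx)

theorem asg1_of {S : Multiset (List V)} (hS : Opt G S) {Act : Finset (List V)} {P : List V}
    (hP : P ∈ S) (h1 : P.length % 3 = 1) {D : Finset V} (hD : ∀ v ∈ P, dm G D v) :
    Asg G S Act P D :=
  ⟨fun _ _ hy ha => absurd ha (noacc1 hS hP h1 hy), fun v hv => Or.inl (hD v hv)⟩

theorem asg1_any {S : Multiset (List V)} (hS : Opt G S) {Act : Finset (List V)} {P : List V}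
    (hP : P ∈ S) (h1 : P.length % 3 = 1) :
    ∃ D, Asg G S Act P D ∧ D.card ≤ P.length / 3 + 1 := by
  have hx : IsEnd P (P.head (by rintro rfl; simp at h1)) := Or.inl (List.head?_eq_some_head _)
  obtain ⟨D, hD1, hD2⟩ := core1 (hS.chain hP) h1 hx
  refine ⟨insert (P.head (by rintro rfl; simp at h1)) D, asg1_of hS hP h1 ?_, ?_⟩
  · intro v hv
    by_cases hvx : v = P.head (by rintro rfl; simp at h1)
    · exact dm_self (hvx ▸ Finset.mem_insert_self _ _)
    · exact (hD2 v hv hvx).mono (Finset.subset_insert _ _)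
  · exact (Finset.card_insert_le _ _).trans (by omega)

theorem asg1_non (hd : Deg3 G) {S : Multiset (List V)} (hS : Opt G S) {Act : Finset (List V)}
    {P : List V} (hP : P ∈ S) (h1 : P.length % 3 = 1) (hn : ¬ Dem G S P) :
    ∃ D, Asg G S Act P D ∧ 8 * D.card ≤ 3 * P.length := by
  by_cases h16 : 16 ≤ P.length
  · obtain ⟨D, hD, hc⟩ := asg1_any (Act := Act) hS hP h1
    exact ⟨D, hD, by omega⟩
  have single : (∃ w, ∀ v ∈ P, w = v ∨ G.Adj w v) → 4 ≤ P.length →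
      ∃ D, Asg G S Act P D ∧ 8 * D.card ≤ 3 * P.length := by
    rintro ⟨w, hw⟩ h4
    refine ⟨{w}, asg1_of hS hP h1 (fun v hv => ⟨w, by simp, hw v hv⟩), ?_⟩
    simp; omega
  have hopt := opt_erase hS hP
  by_cases hdom : P.length = 4 ∧ ∃ w, ∀ v ∈ P, w = v ∨ G.Adj w v
  · exact single hdom.2 (by omega)
  have hin : ¬ (hOut G P ∨ lOut G P) := by
    intro ho
    exact hn ⟨hP, ho, Or.inl ⟨h1, by omega, fun h4 hw => hdom ⟨h4, hw⟩⟩⟩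
  push Not at hin
  have hl : P.length = 1 ∨ P.length = 4 ∨ P.length = 7 ∨ P.length = 10 ∨ P.length = 13 := by omega
  rcases hl with hl | hl | hl
  · exfalso
    match P, hl with
    | [x], _ =>
      obtain ⟨a, ha, -, -⟩ := hd x x x
      apply hin.1
      refine ⟨x, rfl, a, ha, ?_⟩
      simp only [List.mem_singleton]
      rintro rfl; exact G.irrefl ha
  · exfalso
    have noend : ∀ x z, IsEnd P x → G.Adj x z → z ∈ P := by
      intro x z hx hxz
      by_contra hz
      rcases hx with hx | hx
      · exact hin.1 ⟨x, hx, z, hxz, hz⟩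
      · exact hin.2 ⟨x, hx, z, hxz, hz⟩
    rcases O4 hd hopt hl with h | h | ⟨y, hy, hya, -⟩
    · exact hdom ⟨hl, h⟩
    · have hx : IsEnd P (P.head (by rintro rfl; simp at h1)) := Or.inl (List.head?_eq_some_head _)
      obtain ⟨x, z, hx, hxz, hz, -⟩ := h (P.head (by rintro rfl; simp at h1))
      exact hz (noend x z hx hxz)
    · have hx : IsEnd P (P.head (by rintro rfl; simp at h1)) := Or.inl (List.head?_eq_some_head _)
      exact hy (noend _ y hx (hya _ hx.mem).symm)
  · obtain ⟨D, hD1, hD2⟩ := L1 hd hopt hl hin.1 hin.2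
    exact ⟨D, asg1_of hS hP h1 hD2, by omega⟩

theorem acc_core2 {S : Multiset (List V)} (hS : Opt G S) {P : List V} (hP : P ∈ S)
    (h2 : P.length % 3 = 2) {D : Finset V}
    (hD : ∀ A y B, P = A ++ y :: B → A.length % 3 = 2 → B.length % 3 = 2 → y ∈ D) :
    ∀ y ∈ P, AccR G (S.erase P) y → y ∈ D := by
  intro y hy ha
  obtain ⟨A, B, hAB, -⟩ := idx_split hy
  have := KR (opt_erase hS hP) ha hAB
  have hl := congrArg List.length hAB
  simp at hl
  exact hD A y B hAB (by omega) (by omega)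

theorem asg2_both (hd : Deg3 G) {S : Multiset (List V)} (hS : Opt G S) {Act : Finset (List V)}
    {P : List V} (hP : P ∈ S) (h2 : P.length % 3 = 2) (hh : hOut G P) (hl : lOut G P) :
    ∃ D, Asg G S Act P D ∧ D.card ≤ P.length / 3 := by
  obtain ⟨D, hD1, hD2, hD3⟩ := core2 (hS.chain hP) h2
  have cov : ∀ x, IsEnd P x → Out G P x → Cov G S Act x := by
    rintro x hx ⟨y, hxy, hy⟩
    obtain ⟨P', hP', hy'⟩ := hS.exists_mem y
    exact cov_of hP (by omega) hx hxy hy hP' hy'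
      (both_not_dead hd hS hP h2 hh hl hx hxy hy' (fun e => hy (e ▸ hy')))
  refine ⟨D, ⟨fun _ => acc_core2 hS hP h2 hD2, fun v hv => ?_⟩, hD1⟩
  rcases hD3 v hv with h | h | h
  · obtain ⟨x, hx, ho⟩ := hh
    rw [h] at hx; cases hx
    exact Or.inr (cov v (Or.inl h) ho)
  · obtain ⟨x, hx, ho⟩ := hl
    rw [h] at hx; cases hx
    exact Or.inr (cov v (Or.inr h) ho)
  · exact Or.inl h

theorem asg2_any {S : Multiset (List V)} (hS : Opt G S) {Act : Finset (List V)} {P : List V}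
    (hP : P ∈ S) (h2 : P.length % 3 = 2) : ∃ D, Asg G S Act P D ∧ D.card ≤ P.length / 3 + 2 := by
  obtain ⟨D, hD1, hD2, hD3⟩ := core2 (hS.chain hP) h2
  have hne : P ≠ [] := by rintro rfl; simp at h2
  refine ⟨insert (P.head hne) (insert (P.getLast hne) D), ⟨fun _ y hy ha => ?_, fun v hv => ?_⟩, ?_⟩
  · have := acc_core2 hS hP h2 hD2 y hy ha
    simp [this]
  · left
    rcases hD3 v hv with h | h | h
    · rw [List.head?_eq_some_head hne] at h
      cases h
      exact dm_self (by simp)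
    · rw [List.getLast?_eq_some_getLast hne] at h
      cases h
      exact dm_self (by simp)
    · exact h.mono (fun z hz => by simp [hz])
  · have := Finset.card_insert_le (P.head hne) (insert (P.getLast hne) D)
    have := Finset.card_insert_le (P.getLast hne) D
    omega

theorem asg2_served {S : Multiset (List V)} (hS : Opt G S) {Act : Finset (List V)} {P : List V}
    (hP : P ∈ S) (h2 : P.length % 3 = 2) (hs : Served G S Act P) :
    ∃ D, Asg G S Act P D ∧ D.card ≤ P.length / 3 + 1 := by
  obtain ⟨x, y, P', hx, hxy, hy, hP', hy', hnd⟩ := hs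
  have hcov := cov_of hP (by omega) hx hxy hy hP' hy' hnd
  obtain ⟨D, hD1, hD2, hD3⟩ := core2 (hS.chain hP) h2
  have hne : P ≠ [] := by rintro rfl; simp at h2
  obtain ⟨z, hz⟩ : ∃ z, ∀ v, IsEnd P v → v = x ∨ v = z := by
    rcases hx with hx | hx
    · refine ⟨P.getLast hne, ?_⟩
      rintro v (h | h)
      · rw [hx] at h; cases h; exact Or.inl rfl
      · rw [List.getLast?_eq_some_getLast hne] at h; cases h; exact Or.inr rfl
    · refine ⟨P.head hne, ?_⟩
      rintro v (h | h)
      · rw [List.head?_eq_some_head hne] at h; cases h; exact Or.inr rfl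
      · rw [hx] at h; cases h; exact Or.inl rfl
  refine ⟨insert z D, ⟨fun _ y hy ha => ?_, fun v hv => ?_⟩, ?_⟩
  · have := acc_core2 hS hP h2 hD2 y hy ha
    simp [this]
  · have hend : IsEnd P v → dm G (insert z D) v ∨ Cov G S Act v := by
      intro h
      rcases hz v h with rfl | rfl
      · exact Or.inr hcov
      · exact Or.inl (dm_self (by simp))
    rcases hD3 v hv with h | h | h
    · exact hend (Or.inl h)
    · exact hend (Or.inr h)
    · exact Or.inl (h.mono (fun z hz => by simp [hz]))
  · have := Finset.card_insert_le z D
    omega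

theorem asg2_sav {S : Multiset (List V)} {Act : Finset (List V)} {P : List V}
    (h2 : P.length % 3 = 2) (hs : SavS G S P) :
    ∃ D, Asg G S Act P D ∧ D.card ≤ P.length / 3 + 1 := by
  obtain ⟨D, h1, h2, h3⟩ := hs
  exact ⟨D, ⟨fun _ => h1, fun v hv => Or.inl (h2 v hv)⟩, by omega⟩

theorem asg2_dead {S : Multiset (List V)} (hS : Opt G S) {Act : Finset (List V)} {P : List V}
    (hP : P ∈ S) (h2 : P.length % 3 = 2) (hdd : Dead G S Act P) :
    ∃ D, Asg G S Act P D ∧ D.card ≤ P.length / 3 + 1 := by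
  obtain ⟨D, h1, h3⟩ := naive2 (hS.chain hP) h2
  exact ⟨D, ⟨fun h => absurd hdd h, fun v hv => Or.inl (h3 v hv)⟩, h1⟩

theorem served_of_not_dead {S : Multiset (List V)} {Act : Finset (List V)} {P : List V}
    (hP : P ∈ S) (h2 : P.length % 3 = 2) (hs : ¬ SavS G S P) (hf : ¬ Freed G S P) (ha : P ∉ Act)
    (hnd : ¬ Dead G S Act P) : Served G S Act P := by
  by_contra hns
  apply hnd
  refine Dead.mk P hP h2 hs hf ha ?_
  intro x y P' hx hxy hy hP' hy'
  by_contra h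
  exact hns ⟨x, y, P', hx, hxy, hy, hP', hy', h⟩

/-- order 5 with an inner end -/
theorem five_w (hd : Deg3 G) {S : Multiset (List V)} (hS : Opt G S) {P : List V}
    (hP : P ∈ S) (h5 : P.length = 5) (hb : ¬ (hOut G P ∧ lOut G P)) :
    ∃ w x, IsEnd P x ∧ (∀ y ∈ P, AccR G (S.erase P) y → y = w) ∧
      (∀ v ∈ P, v ≠ x → w = v ∨ G.Adj w v) ∧ (hOut G P ∨ lOut G P → ∀ u, IsEnd P u → Out G P u → u = x) := by
  have hopt := opt_erase hS hP
  have hne : P ≠ [] := by rintro rfl; simp at h5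
  by_cases h1 : hOut G P
  · have h3 : ¬ lOut G P := fun h => hb ⟨h1, h⟩
    obtain ⟨w, -, hw1, hw2⟩ := O5one hd hopt.rev (by simpa using h5) (by rwa [hOut_reverse])
    refine ⟨w, P.head hne, Or.inl (List.head?_eq_some_head _), ?_, ?_, ?_⟩
    · intro y hy; exact hw1 y (by simpa using hy)
    · intro v hv hvx
      refine hw2 v (by simpa using hv) ?_
      rw [List.getLast?_reverse, List.head?_eq_some_head hne]
      intro h; cases h; exact hvx rfl
    · rintro - u (hu | hu) ho
      · rw [List.head?_eq_some_head hne] at hu; cases hu; rfl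
      · exact absurd ⟨u, hu, ho⟩ h3
  · obtain ⟨w, -, hw1, hw2⟩ := O5one hd hopt h5 h1
    refine ⟨w, P.getLast hne, Or.inr (List.getLast?_eq_some_getLast _), hw1, ?_, ?_⟩
    · intro v hv hvx
      refine hw2 v hv ?_
      rw [List.getLast?_eq_some_getLast hne]
      intro h; cases h; exact hvx rfl
    · rintro - u (hu | hu) ho
      · exact absurd ⟨u, hu, ho⟩ h1
      · rw [List.getLast?_eq_some_getLast hne] at hu; cases hu; rfl

theorem five_sav (hd : Deg3 G) {S : Multiset (List V)} (hS : Opt G S) {P : List V}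
    (hP : P ∈ S) (h5 : P.length = 5) (hb : ¬ (hOut G P ∧ lOut G P)) : SavS G S P := by
  obtain ⟨w, x, hx, h1, h2, -⟩ := five_w hd hS hP h5 hb
  refine ⟨{w, x}, ?_, ?_, ?_⟩
  · intro y hy ha; simp [h1 y hy ha]
  · intro v hv
    by_cases hvx : v = x
    · exact dm_self (by simp [hvx])
    · exact ⟨w, by simp, h2 v hv hvx⟩
  · have := Finset.card_le_two (a := w) (b := x)
    omega

theorem five_in (hd : Deg3 G) {S : Multiset (List V)} (hS : Opt G S) {Act : Finset (List V)}
    {P : List V} (hP : P ∈ S) (h5 : P.length = 5) (h1 : ¬ hOut G P) (h2 : ¬ lOut G P) :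
    ∃ D, Asg G S Act P D ∧ D.card ≤ 1 := by
  obtain ⟨w, -, hw1, hw2⟩ := O5in hd (opt_erase hS hP) h5 h1 h2
  exact ⟨{w}, ⟨fun _ y hy ha => by simp [hw1 y hy ha], fun v hv => Or.inl ⟨w, by simp, hw2 v hv⟩⟩,
    by simp⟩

theorem five_served (hd : Deg3 G) {S : Multiset (List V)} (hS : Opt G S) {Act : Finset (List V)}
    {P : List V} (hP : P ∈ S) (h5 : P.length = 5) (hb : ¬ (hOut G P ∧ lOut G P))
    (ho : hOut G P ∨ lOut G P) (hs : Served G S Act P) :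
    ∃ D, Asg G S Act P D ∧ D.card ≤ 1 := by
  obtain ⟨w, x, hx, h1, h2, h3⟩ := five_w hd hS hP h5 hb
  obtain ⟨u, y, P', hu, huy, hy, hP', hy', hnd⟩ := hs
  have hux := h3 ho u hu ⟨y, huy, hy⟩
  subst hux
  refine ⟨{w}, ⟨fun _ y hy ha => by simp [h1 y hy ha], fun v hv => ?_⟩, by simp⟩
  by_cases hvx : v = u
  · subst hvx
    exact Or.inr (cov_of hP (by omega) hu huy hy hP' hy' hnd)
  · exact Or.inl ⟨w, by simp, h2 v hv hvx⟩

variable (G) in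
/-- admissible activation sets -/
def Val (S : Multiset (List V)) (Act : Finset (List V)) : Prop :=
  ∀ P ∈ Act, P ∈ S ∧ P.length % 3 = 2 ∧ ¬ hOut G P ∧ ¬ lOut G P ∧ ¬ SavS G S P ∧ ¬ Freed G S P

open Classical in
theorem gain (hd : Deg3 G) {S : Multiset (List V)} (hS : Opt G S) {Act : Finset (List V)}
    (hA : Val G S Act) {P : List V} (hP : P ∈ S) :
    ∃ D, Asg G S Act P D ∧
      8 * (D.card : ℤ) + (if Dem G S P ∧ Served G S Act P then 3 else 0)
        + (if IsFreer G S P then 7 else 0)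
        + (if Dead G S Act P then (((P.length / 3 : ℕ) : ℤ) - 2) else 0)
      ≤ 3 * (P.length : ℤ) + (if Freed G S P then 7 else 0) + (if P ∈ Act then 5 else 0)
        + (if Dem G S P ∧ ¬ Served G S Act P then
            ∑ q ∈ supp G S Act P, (((q.length / 3 : ℕ) : ℤ) - 2) else 0) := by
  have hm : P.length % 3 = 0 ∨ P.length % 3 = 1 ∨ P.length % 3 = 2 := by omega
  have hFr2 : IsFreer G S P → P.length % 3 = 2 → 5 ≤ P.length ∧ hOut G P ∧ lOut G P := by
    rintro ⟨P2, -, -, -, y, -, -, h | h⟩ h2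
    · exact h.2
    · omega
  have hDem2 : Dem G S P → P.length % 3 = 1 ∨ P.length = 5 ∧ ¬ (hOut G P ∧ lOut G P) := by
    rintro ⟨-, -, h | h⟩
    · exact Or.inl h.1
    · exact Or.inr h
  have hneed := fun (h1 : Dem G S P) (h2 : ¬ Served G S Act P) => need_le hd hS h1 h2
  generalize (∑ q ∈ supp G S Act P, (((q.length / 3 : ℕ) : ℤ) - 2)) = X at hneed ⊢
  by_cases h2 : P.length % 3 = 2
  · by_cases hb : hOut G P ∧ lOut G P
    · obtain ⟨D, hD, hc⟩ := asg2_both (Act := Act) hd hS hP h2 hb.1 hb.2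
      refine ⟨D, hD, ?_⟩
      have e1 : ¬ Dem G S P := fun h => by
        rcases hDem2 h with h | h
        · omega
        · exact h.2 hb
      have e2 : ¬ Dead G S Act P := fun h => h.notBoth hd hS hb
      have e3 : ¬ Freed G S P := fun h => h.2.2.2.1 hb
      have e4 : P ∉ Act := fun h => (hA P h).2.2.1 hb.1
      simp only [e1, e2, e3, e4, false_and, if_false]
      split_ifs with hf
      · have := (hFr2 hf h2).1
        omega
      · omega
    · have e0 : ¬ IsFreer G S P := fun h => hb (hFr2 h h2).2
      by_cases hl2 : P.length = 2
      · exfalso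
        apply hb
        have hne : P ≠ [] := by rintro rfl; simp at h2
        constructor
        · obtain ⟨z, hz, hz1, -⟩ := two_two hd hl2 (P.head hne)
            (x := P.head hne) (Or.inl (List.head?_eq_some_head _))
          exact ⟨_, List.head?_eq_some_head _, z, hz, hz1⟩
        · obtain ⟨z, hz, hz1, -⟩ := two_two hd hl2 (P.head hne)
            (x := P.getLast hne) (Or.inr (List.getLast?_eq_some_getLast _))
          exact ⟨_, List.getLast?_eq_some_getLast _, z, hz, hz1⟩
      by_cases hl5 : P.length = 5
      · have hsv := five_sav hd hS hP hl5 hb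
        have e2 : ¬ Dead G S Act P := fun h => h.out.2.2.1 hsv
        have e3 : ¬ Freed G S P := fun h => h.2.2.1 hsv
        have e4 : P ∉ Act := fun h => (hA P h).2.2.2.2.1 hsv
        simp only [e0, e2, e3, e4, if_false]
        by_cases ho : hOut G P ∨ lOut G P
        · have e1 : Dem G S P := ⟨hP, ho, Or.inr ⟨hl5, hb⟩⟩
          by_cases hs : Served G S Act P
          · obtain ⟨D, hD, hc⟩ := five_served hd hS hP hl5 hb ho hs
            refine ⟨D, hD, ?_⟩
            simp only [e1, hs, true_and, if_true, not_true, and_false, if_false, and_true]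
            omega
          · obtain ⟨D, hD, hc⟩ := asg2_sav (Act := Act) h2 hsv
            refine ⟨D, hD, ?_⟩
            have := hneed e1 hs
            simp only [e1, hs, true_and, if_true, and_false, if_false, not_false_eq_true]
            omega
        · have e1 : ¬ Dem G S P := fun h => ho h.2.1
          push Not at ho
          obtain ⟨D, hD, hc⟩ := five_in (Act := Act) hd hS hP hl5 ho.1 ho.2
          refine ⟨D, hD, ?_⟩
          simp only [e1, false_and, if_false]
          omega
      · have e1 : ¬ Dem G S P := fun h => by
          rcases hDem2 h with h | h <;> omega
        simp only [e0, e1, false_and, if_false]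
        by_cases hsv : SavS G S P
        · have e2 : ¬ Dead G S Act P := fun h => h.out.2.2.1 hsv
          have e3 : ¬ Freed G S P := fun h => h.2.2.1 hsv
          have e4 : P ∉ Act := fun h => (hA P h).2.2.2.2.1 hsv
          obtain ⟨D, hD, hc⟩ := asg2_sav (Act := Act) h2 hsv
          refine ⟨D, hD, ?_⟩
          simp only [e2, e3, e4, if_false]
          omega
        have hpos := Finset.card_pos.2 (accF_pos hS hP h2 hsv)
        by_cases hf : Freed G S P
        · have e2 : ¬ Dead G S Act P := fun h => h.out.2.2.2.1 hf
          have e4 : P ∉ Act := fun h => (hA P h).2.2.2.2.2 hf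
          obtain ⟨D, hD, hc⟩ := asg2_any (Act := Act) hS hP h2
          refine ⟨D, hD, ?_⟩
          have := acc_one hd hS hP h2 hsv hb
          simp only [hf, e2, e4, if_false, if_true]
          omega
        by_cases ha : P ∈ Act
        · have e2 : ¬ Dead G S Act P := fun h => h.out.2.2.2.2.1 ha
          obtain ⟨D, hD, hc⟩ := asg2_any (Act := Act) hS hP h2
          refine ⟨D, hD, ?_⟩
          have := acc_in hd hS hP h2 hsv (hA P ha).2.2.1 (hA P ha).2.2.2.1
          simp only [hf, e2, ha, if_false, if_true]
          omega
        by_cases hdd : Dead G S Act P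
        · obtain ⟨D, hD, hc⟩ := asg2_dead hS hP h2 hdd
          refine ⟨D, hD, ?_⟩
          simp only [hf, hdd, ha, if_false, if_true]
          omega
        · obtain ⟨D, hD, hc⟩ := asg2_served hS hP h2 (served_of_not_dead hP h2 hsv hf ha hdd)
          refine ⟨D, hD, ?_⟩
          simp only [hf, hdd, ha, if_false, if_true]
          omega
  · have e2 : ¬ Dead G S Act P := fun h => h2 h.out.2.1
    have e3 : ¬ Freed G S P := fun h => h2 h.2.1
    have e4 : P ∉ Act := fun h => h2 (hA P h).2.1
    simp only [e2, e3, e4, if_false]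
    by_cases h0 : P.length % 3 = 0
    · have e0 : ¬ IsFreer G S P := by
        rintro ⟨P2, -, -, -, y, -, -, h | h⟩ <;> omega
      have e1 : ¬ Dem G S P := fun h => by
        rcases hDem2 h with h | h <;> omega
      obtain ⟨D, hD, hc⟩ := asg0 (Act := Act) hS hP h0
      refine ⟨D, hD, ?_⟩
      simp only [e0, e1, false_and, if_false]
      omega
    have h1 : P.length % 3 = 1 := by omega
    by_cases e0 : IsFreer G S P
    · obtain ⟨h4, hD⟩ := asg1_freer (Act := Act) hS hP h1 e0
      refine ⟨∅, hD, ?_⟩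
      simp only [e0, if_true]
      by_cases e1 : Dem G S P
      · by_cases hs : Served G S Act P
        · simp [e1, hs, h4]
        · have := hneed e1 hs
          simp only [e1, hs, and_false, if_false, not_false_eq_true, and_self, if_true,
            Finset.card_empty]
          rw [h4] at this ⊢
          norm_num at this ⊢
          linarith
      · simp [e1, h4]
    · simp only [e0, if_false]
      by_cases e1 : Dem G S P
      · by_cases hs : Served G S Act P
        · obtain ⟨D, hD, hc⟩ := asg1_served hS hP h1 hs
          refine ⟨D, hD, ?_⟩
          simp only [e1, hs, true_and, if_true, not_true, and_false, if_false, and_true]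
          omega
        · obtain ⟨D, hD, hc⟩ := asg1_any (Act := Act) hS hP h1
          refine ⟨D, hD, ?_⟩
          have := hneed e1 hs
          simp only [e1, hs, true_and, if_true, and_false, if_false, not_false_eq_true]
          omega
      · obtain ⟨D, hD, hc⟩ := asg1_non (Act := Act) hd hS hP h1 e1
        refine ⟨D, hD, ?_⟩
        simp only [e1, false_and, if_false]
        omega

end AsgSec
end Reed

open SimpleGraph Set

set_option linter.unusedSectionVars false
set_option linter.unusedSimpArgs false
namespace Reed

section SumSec
variable {V : Type*} [Fintype V] [DecidableEq V] (G : SimpleGraph V)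

open Classical in
/-- the served demanders -/
noncomputable def srv (S : Multiset (List V)) (Act : Finset (List V)) : Finset (List V) :=
  S.toFinset.filter (fun P => Dem G S P ∧ Served G S Act P)

variable {G}

theorem mem_srv {S : Multiset (List V)} {Act : Finset (List V)} {P : List V} :
    P ∈ srv G S Act ↔ Dem G S P ∧ Served G S Act P := by
  unfold srv
  simp only [Finset.mem_filter, Multiset.mem_toFinset, and_iff_right_iff_imp]
  exact fun h => h.1.1

theorem exists_act {S : Multiset (List V)} (hS : Opt G S) : ∃ Act : Finset (List V), Val G S Act ∧
    2 * Act.card ≤ (srv G S Act).card ∧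
    ∀ δ1 δ2 q, Dem G S δ1 → Dem G S δ2 → ¬ Served G S Act δ1 → ¬ Served G S Act δ2 →
      q ∈ supp G S Act δ1 → q ∈ supp G S Act δ2 → δ1 = δ2 := by
  classical
  have hne : (S.toFinset.powerset.filter
      (fun A => Val G S A ∧ 2 * A.card ≤ (srv G S A).card)).Nonempty := by
    refine ⟨∅, Finset.mem_filter.2 ⟨by simp, ?_, by simp⟩⟩
    intro P hP
    simp at hP
  obtain ⟨Act, hAct, hmax⟩ := Finset.exists_max_image _ Finset.card hne
  simp only [Finset.mem_filter, Finset.mem_powerset] at hAct hmax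
  refine ⟨Act, hAct.2.1, hAct.2.2, ?_⟩
  intro δ1 δ2 q hd1 hd2 hu1 hu2 hq1 hq2
  by_contra hne
  obtain ⟨hq, hq1⟩ := mem_supp.1 hq1
  obtain ⟨-, hq2⟩ := mem_supp.1 hq2
  obtain ⟨r, hr, hr1, hr2, hr3⟩ := hq.root hS
  have ho := hr.out
  have hsub : Act ⊆ insert r Act := Finset.subset_insert _ _
  have hnd : ¬ Dead G S (insert r Act) q := fun h =>
    (hr3 _ h).out.2.2.2.2.1 (Finset.mem_insert_self _ _)
  have hs1 := hq1 _ hsub hnd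
  have hs2 := hq2 _ hsub hnd
  have hcard : (insert r Act).card = Act.card + 1 := Finset.card_insert_of_notMem ho.2.2.2.2.1
  have hss : insert δ1 (insert δ2 (srv G S Act)) ⊆ srv G S (insert r Act) := by
    intro P hP
    simp only [Finset.mem_insert] at hP
    rcases hP with rfl | rfl | hP
    · exact mem_srv.2 ⟨hd1, hs1⟩
    · exact mem_srv.2 ⟨hd2, hs2⟩
    · obtain ⟨h1, h2⟩ := mem_srv.1 hP
      exact mem_srv.2 ⟨h1, h2.mono hsub⟩
  have hc := Finset.card_le_card hss
  rw [Finset.card_insert_of_notMem, Finset.card_insert_of_notMem] at hc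
  · have := hmax (insert r Act) ⟨?_, ?_, by omega⟩
    · omega
    · intro P hP
      rcases Finset.mem_insert.1 hP with rfl | hP
      · simpa using ho.1
      · exact hAct.1 hP
    · intro P hP
      rcases Finset.mem_insert.1 hP with rfl | hP
      · exact ⟨ho.1, ho.2.1, hr1, hr2, ho.2.2.1, ho.2.2.2.1⟩
      · exact hAct.2.1 P hP
  · exact fun h => hu2 (mem_srv.1 h).2
  · simp only [Finset.mem_insert, not_or]
    exact ⟨hne, fun h => hu1 (mem_srv.1 h).2⟩

open Classical in
theorem freed_card {S : Multiset (List V)} (hS : Opt G S) :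
    (S.toFinset.filter (fun P => Freed G S P)).card ≤
      (S.toFinset.filter (fun P => IsFreer G S P)).card := by
  have hex : ∀ P2, ∃ P1, Freed G S P2 → Freer G S P1 P2 := by
    intro P2
    by_cases h : Freed G S P2
    · obtain ⟨P1, h1⟩ := h.2.2.2.2
      exact ⟨P1, fun _ => h1⟩
    · exact ⟨[], fun h' => absurd h' h⟩
  choose f hf using hex
  apply Finset.card_le_card_of_injOn f
  · intro P hP
    simp only [Finset.coe_filter, Multiset.mem_toFinset, Set.mem_ofPred_eq] at hP ⊢
    exact ⟨(hf P hP.2).1, P, hP.2, hf P hP.2⟩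
  · intro P hP Q hQ he
    simp only [Finset.coe_filter, Multiset.mem_toFinset, Set.mem_ofPred_eq] at hP hQ
    obtain ⟨h1, hne, y, hy, hyu, hor⟩ := hf P hP.2
    obtain ⟨h1', hne', y', hy', hyu', hor'⟩ := hf Q hQ.2
    rw [← he] at h1' hne' hyu' hor'
    generalize f P = P1 at *
    have hyP1 : y ∉ P1 := fun h => hne (hS.eq_of_mem h1 hP.1 h hy)
    have key : ∃ x, ∃ u, IsEnd P1 x ∧ G.Adj x u ∧ u ∉ P1 := by
      rcases hor with ⟨-, -, ⟨x, hx, u, hxu, hu⟩, -⟩ | ⟨h4, hya, -⟩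
      · exact ⟨x, u, Or.inl hx, hxu, hu⟩
      · have hx : IsEnd P1 (P1.head (by rintro rfl; simp at h4)) :=
          Or.inl (List.head?_eq_some_head _)
        exact ⟨_, y, hx, (hya _ hx.mem).symm, hyP1⟩
    obtain ⟨x, u, hx, hxu, hu⟩ := key
    have e1 := hyu x u hx hxu hu
    have e2 := hyu' x u hx hxu hu
    subst e1
    subst e2
    exact hS.eq_of_mem hP.1 hQ.1 hy hy'

theorem sum_len {S : Multiset (List V)} (hS : Opt G S) :
    ∑ P ∈ S.toFinset, P.length ≤ Fintype.card V := by
  classical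
  have h : (S.toFinset.biUnion (fun P => P.toFinset)).card = ∑ P ∈ S.toFinset, P.toFinset.card := by
    apply Finset.card_biUnion
    intro P hP Q hQ hne
    simp only [Function.onFun]
    rw [Finset.disjoint_left]
    intro y hy hy'
    simp only [List.mem_toFinset, Multiset.mem_toFinset, Finset.mem_coe] at *
    exact hne (hS.eq_of_mem hP hQ hy hy')
  calc ∑ P ∈ S.toFinset, P.length = ∑ P ∈ S.toFinset, P.toFinset.card := by
        apply Finset.sum_congr rfl
        intro P hP
        rw [List.toFinset_card_of_nodup (hS.nodup (by simpa using hP))]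
    _ = _ := h.symm
    _ ≤ _ := Finset.card_le_univ _

/-- Reed's theorem -/
theorem reed (hd : Deg3 G) : ∃ D : Finset V, (∀ v, dm G D v) ∧ 8 * D.card ≤ 3 * Fintype.card V := by
  classical
  obtain ⟨S, hS⟩ := exists_opt (G := G)
  obtain ⟨Act, hA, hA2, hdis⟩ := exists_act hS
  have hg : ∀ P : List V, ∃ D : Finset V, P ∈ S → _ := fun P => by
    by_cases hP : P ∈ S
    · obtain ⟨D, hD⟩ := gain hd hS hA hP
      exact ⟨D, fun _ => hD⟩
    · exact ⟨∅, fun h => absurd h hP⟩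
  choose D hD using hg
  refine ⟨S.toFinset.biUnion D, ?_, ?_⟩
  · intro v
    obtain ⟨P, hP, hv⟩ := hS.exists_mem v
    rcases (hD P hP).1.2 v hv with h | ⟨P', hP', y, hy, hyv, hacc, hnd⟩
    · exact h.mono (Finset.subset_biUnion_of_mem D (by simpa using hP))
    · have := (hD P' hP').1.1 hnd y hy hacc
      exact dm_adj (Finset.mem_biUnion.2 ⟨P', by simpa using hP', this⟩) hyv
  · have hsum := Finset.sum_le_sum (s := S.toFinset) (fun P hP => (hD P (by simpa using hP)).2)
    simp only [Finset.sum_add_distrib, ← Finset.mul_sum] at hsum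
    have hc : (S.toFinset.biUnion D).card ≤ ∑ P ∈ S.toFinset, (D P).card := Finset.card_biUnion_le
    have hl := sum_len hS
    have c1 : ∀ (p : List V → Prop) [DecidablePred p] (c : ℤ), ∑ P ∈ S.toFinset, (if p P then c else 0) =
        c * ((S.toFinset.filter p).card : ℤ) := by
      intro p _ c
      rw [← Finset.sum_filter, Finset.sum_const, nsmul_eq_mul, mul_comm]
    have e1 := c1 (fun P => Dem G S P ∧ Served G S Act P) 3
    have e2 := c1 (fun P => IsFreer G S P) 7
    have e3 := c1 (fun P => Freed G S P) 7
    have e4 := c1 (fun P => P ∈ Act) 5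
    have hf := freed_card hS
    have ha : (S.toFinset.filter (fun P => P ∈ Act)).card ≤ Act.card :=
      Finset.card_le_card (fun P hP => (Finset.mem_filter.1 hP).2)
    have hs : (srv G S Act).card =
      (S.toFinset.filter (fun P => Dem G S P ∧ Served G S Act P)).card := rfl
    have hdead : ∑ P ∈ S.toFinset, (if Dem G S P ∧ ¬ Served G S Act P then
            ∑ q ∈ supp G S Act P, (((q.length / 3 : ℕ) : ℤ) - 2) else 0) ≤
        ∑ P ∈ S.toFinset, (if Dead G S Act P then (((P.length / 3 : ℕ) : ℤ) - 2) else 0) := by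
      rw [← Finset.sum_filter, ← Finset.sum_filter, ← Finset.sum_biUnion]
      · apply Finset.sum_le_sum_of_subset_of_nonneg
        · intro q hq
          obtain ⟨P, hP, hq⟩ := Finset.mem_biUnion.1 hq
          have := (mem_supp.1 hq).1
          simp [this, this.out.1]
        · intro q hq _
          have hdq := (Finset.mem_filter.1 hq).2
          have ho := hdq.out
          have := acc_one hd hS ho.1 ho.2.1 ho.2.2.1 (hdq.notBoth hd hS)
          omega
      · intro P hP Q hQ hne
        simp only [Function.onFun]
        rw [Finset.disjoint_left]
        intro q hq hq'
        simp only [Finset.coe_filter, Set.mem_ofPred_eq] at hP hQ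
        exact hne (hdis P Q q hP.2.1 hQ.2.1 hP.2.2 hQ.2.2 hq hq')
    have hc' : ((S.toFinset.biUnion D).card : ℤ) ≤ ∑ P ∈ S.toFinset, ((D P).card : ℤ) := by
      exact_mod_cast hc
    have hl' : ∑ P ∈ S.toFinset, (P.length : ℤ) ≤ Fintype.card V := by exact_mod_cast hl
    rw [e1, e2, e3, e4] at hsum
    zify at hf ha hA2 ⊢
    rw [hs] at hA2
    linarith

end SumSec
end Reed

theorem obs_mono_univ (G : SimpleGraph V) (S : Set V) (h : closedNbhdSet G S = Set.univ) :
    ptpd G S = 1 := by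
  unfold ptpd
  have h1 : (1 : ℕ) ∈ {t | 1 ≤ t ∧ obs G S t = Set.univ} := ⟨le_refl _, h⟩
  exact le_antisymm (Nat.sInf_le h1) (Nat.sInf_mem ⟨1, h1⟩).1

theorem ptpd_mem (G : SimpleGraph V) (S : Set V) (h : IsPDS G S) :
    1 ≤ ptpd G S ∧ obs G S (ptpd G S) = Set.univ := by
  have hne : {t | 1 ≤ t ∧ obs G S t = Set.univ}.Nonempty := by
    obtain ⟨t, ht⟩ := h
    rcases Nat.eq_zero_or_pos t with rfl | hp
    · refine ⟨1, le_refl _, ?_⟩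
      have ht' : S = Set.univ := ht
      change S ∪ _ = Set.univ
      rw [ht', Set.univ_union]
    · exact ⟨t, hp, ht⟩
  exact Nat.sInf_mem hne

theorem gamma_reed [Fintype V] (G : SimpleGraph V) [DecidableRel G.Adj] (hδ : 3 ≤ G.minDegree) :
    8 * gamma G ≤ 3 * Fintype.card V := by
  classical
  have hd : Reed.Deg3 G := by
    intro v b1 b2
    have h1 : 3 ≤ (G.neighborFinset v).card := hδ.trans (G.minDegree_le_degree v)
    have h2 : ({b1, b2} : Finset V).card ≤ 2 := Finset.card_le_two
    obtain ⟨z, hz, hz'⟩ := Finset.exists_mem_notMem_of_card_lt_card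
      (lt_of_le_of_lt h2 (by omega : 2 < (G.neighborFinset v).card))
    simp only [Finset.mem_insert, Finset.mem_singleton, not_or] at hz'
    exact ⟨z, by simpa using hz, hz'.1, hz'.2⟩
  obtain ⟨D, hD, hc⟩ := Reed.reed hd
  have hg : gamma G ≤ D.card := by
    apply Nat.sInf_le
    refine ⟨(D : Set V), ?_, Set.ncard_coe_finset D⟩
    rw [IsDomSet, Set.eq_univ_iff_forall]
    intro v
    obtain ⟨d, hdD, rfl | hdv⟩ := hD v
    · exact Or.inl hdD
    · exact Or.inr ⟨d, hdD, hdv⟩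
  omega

theorem stmt10 [Fintype V] (G : SimpleGraph V) [DecidableRel G.Adj] (hG : G.Connected)
    (hδ : 3 ≤ G.minDegree)
    (h : 3 * (Fintype.card V : ℝ) / 16 ≤ (gammaP G : ℝ)) :
    thpd G = gamma G := by
  have hreed := gamma_reed G hδ
  have hdomuniv : IsDomSet G (Set.univ : Set V) := Set.univ_union _
  apply le_antisymm
  · obtain ⟨S, hS, hc⟩ := Nat.sInf_mem
      (⟨_, Set.univ, hdomuniv, rfl⟩ : {k | ∃ S : Set V, IsDomSet G S ∧ S.ncard = k}.Nonempty)
    apply Nat.sInf_le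
    refine ⟨S, ⟨1, hS⟩, ?_⟩
    rw [obs_mono_univ G S hS, mul_one, hc]
    rfl
  · apply le_csInf
    · exact ⟨_, Set.univ, ⟨0, rfl⟩, rfl⟩
    · rintro m ⟨S, hS, rfl⟩
      obtain ⟨h1, h2⟩ := ptpd_mem G S hS
      by_cases hp : ptpd G S = 1
      · rw [hp] at h2 ⊢
        rw [mul_one]
        exact Nat.sInf_le ⟨S, h2, rfl⟩
      · have hP : gammaP G ≤ S.ncard := Nat.sInf_le ⟨S, hS, rfl⟩
        have h3 : S.ncard * 2 ≤ S.ncard * ptpd G S := Nat.mul_le_mul_left _ (by omega)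
        have h4 : 3 * Fintype.card V ≤ 16 * gammaP G := by
          have : (3 * Fintype.card V : ℝ) ≤ 16 * gammaP G := by linarith
          exact_mod_cast this
        omega
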